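/- Fix an integer p ≥ 2 and c ∈ (0,1/2), and let γ_n, β_n, α_n, θ_n, a_n, c_n, k_n(t) be as in the standing setup. Define the environment-measurable random variable ν̄_n^t(u,∞) = k_n(t)·𝒫(max_{1≤j≤θ_n} e^{β_n H_n(J_n(j))} e_{n,j} > c_n u^{β_n/γ_n} | H_n). Then for every u > 0 and t > 0 there exists a constant C = C(p,t,u) < ∞ such that for all sufficiently large n, 𝔼[(ν̄_n^t(u,∞) − 𝔼 ν̄_n^t(u,∞))²] ≤ C·γ_n^{-2}·n^{1−p/2}; the same bound holds when u is replaced by u_n = u·θ_n^{−α_n}. -/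

import Mathlib

open MeasureTheory ProbabilityTheory Filter Real Finset

/-- Configuration space: the hypercube `Σ_n = {−1,1}^n`, encoded as `Fin n → Bool`,
with the Hamming distance as graph distance. -/
abbrev V (n : ℕ) := Fin n → Bool

/-- Overlap `R_n(x,x') = 1 − 2·dist(x,x')/n`. -/
noncomputable def overlap (n : ℕ) (x y : V n) : ℝ := 1 - 2 * (hammingDist x y : ℝ) / n

/-- `γ_n = n^{-c}`. -/
noncomputable def γseq (c : ℝ) (n : ℕ) : ℝ := (n : ℝ) ^ (-c)

/-- Block length `θ_n = 3n²`. -/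
def θseq (n : ℕ) : ℕ := 3 * n ^ 2

/-- Jump scale `a_n = √(2πn)·γ_n⁻¹·e^{γ_n²n/2}`. -/
noncomputable def aseq (c : ℝ) (n : ℕ) : ℝ :=
  Real.sqrt (2 * π * n) * (γseq c n)⁻¹ * Real.exp ((γseq c n) ^ 2 * n / 2)

/-- Time scale `c_n = e^{γ_nβ_n n}`. -/
noncomputable def cseq (c : ℝ) (β : ℕ → ℝ) (n : ℕ) : ℝ := Real.exp (γseq c n * β n * n)

/-- `k_n(t) = ⌊⌊a_n t⌋/θ_n⌋`. -/
noncomputable def kseq (c : ℝ) (n : ℕ) (t : ℝ) : ℕ := ⌊aseq c n * t⌋₊ / θseq n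

/-- `X` is a centered Gaussian random vector with covariance `Δ`: every linear combination
of its coordinates is a centered real Gaussian with the corresponding variance. -/
def IsCenteredGaussianVector {Ω : Type*} [MeasurableSpace Ω] (P : Measure Ω)
    {I : Type*} [Fintype I] (X : I → Ω → ℝ) (Δ : I → I → ℝ) : Prop :=
  ∀ c : I → ℝ, Measure.map (fun ω => ∑ i, c i * X i ω) P =
    gaussianReal 0 (Real.toNNReal (∑ i, ∑ j, c i * c j * Δ i j))

/-- Joint law of the dynamics: `J n` is the simple random walk on `Σ_n` started from the
uniform distribution, `(e n j)` are i.i.d. mean-one exponentials, and the walk and the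
exponentials are independent; all of this is encoded through the joint finite-dimensional
distributions. -/
def WalkExpLaw {Ω' : Type*} [MeasurableSpace Ω'] (Pw : Measure Ω')
    (J : (n : ℕ) → ℕ → Ω' → V n) (e : ℕ → ℕ → Ω' → ℝ) : Prop :=
  ∀ (n m : ℕ) (xs : Fin (m + 1) → V n) (ys : Fin (m + 1) → ℝ), (∀ k, 0 ≤ ys k) →
    Pw {ω' | (∀ k : Fin (m + 1), J n k ω' = xs k) ∧ (∀ k : Fin (m + 1), ys k < e n k ω')} =
      ENNReal.ofReal (((2 : ℝ) ^ n)⁻¹ *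
        ∏ k : Fin m, (if hammingDist (xs k.castSucc) (xs k.succ) = 1 then (n : ℝ)⁻¹ else 0)) *
      ENNReal.ofReal (Real.exp (-∑ k, ys k))

/-- `ν̄_n^t(u,∞) = k_n(t)·𝒫(max_{1≤j≤θ_n} e^{β_n h(J_n(j))} e_{n,j} > c_n u^{β_n/γ_n})`,
for a fixed realization `h` of the environment. -/
noncomputable def nuMax {Ω' : Type*} [MeasurableSpace Ω'] (Pw : Measure Ω')
    (J : (n : ℕ) → ℕ → Ω' → V n) (e : ℕ → ℕ → Ω' → ℝ)
    (c : ℝ) (β : ℕ → ℝ) (n : ℕ) (t u : ℝ) (h : V n → ℝ) : ℝ :=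
  (kseq c n t : ℝ) *
    (Pw {ω' | ∃ j ∈ Icc 1 (θseq n), cseq c β n * u ^ (β n / γseq c n) <
      Real.exp (β n * h (J n j ω')) * e n j ω'}).toReal


section

open MeasureTheory ProbabilityTheory Filter Real Finset

lemma aux_hasDerivAt_pdf (v : NNReal) (hv : v ≠ 0) (s : ℝ) :
    HasDerivAt (gaussianPDFReal 0 v) (-(s / v) * gaussianPDFReal 0 v s) s := by
  have hv' : (v : ℝ) ≠ 0 := by exact_mod_cast hv
  have h1 : HasDerivAt (fun x : ℝ => -(x - 0) ^ 2 / (2 * (v : ℝ))) (-(s / v)) s := by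
    have h0 : HasDerivAt (fun x : ℝ => (x - 0) ^ 2) (2 * s) s := by
      have := hasDerivAt_pow 2 s
      simpa using this
    refine (h0.neg.div_const (2 * (v : ℝ))).congr_deriv ?_
    field_simp
  have h2 := (h1.exp).const_mul ((√(2 * π * v))⁻¹)
  have e : gaussianPDFReal 0 v = fun x => (√(2 * π * v))⁻¹ * rexp (-(x - 0) ^ 2 / (2 * v)) := by
    ext x; simp [gaussianPDFReal]
  rw [e]
  refine h2.congr_deriv ?_
  ring

lemma aux_stein (v : NNReal) (hv : v ≠ 0) (f f' : ℝ → ℝ) (hf : ∀ s, HasDerivAt f (f' s) s)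
    (hf'c : Continuous f')
    (M M' : ℝ) (hM : ∀ s, |f s| ≤ M) (hM' : ∀ s, |f' s| ≤ M') :
    ∫ s, s * f s ∂(gaussianReal 0 v) = v * ∫ s, f' s ∂(gaussianReal 0 v) := by
  have hv' : (v : ℝ) ≠ 0 := by exact_mod_cast hv
  have hfc : Continuous f := continuous_iff_continuousAt.2 fun s => (hf s).continuousAt
  have hpi : Integrable (gaussianPDFReal 0 v) := integrable_gaussianPDFReal 0 v
  have hid : Integrable (fun s : ℝ => s) (gaussianReal 0 v) := by
    have := IsGaussian.integrable_id (μ := gaussianReal 0 v)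
    exact this
  have hpid : Integrable (fun s => s * gaussianPDFReal 0 v s) := by
    rw [gaussianReal_of_var_ne_zero _ hv] at hid
    rw [integrable_withDensity_iff (measurable_gaussianPDF 0 v) (by simp [gaussianPDF])] at hid
    refine hid.congr (Eventually.of_forall fun s => ?_)
    simp [gaussianPDF, ENNReal.toReal_ofReal (gaussianPDFReal_nonneg 0 v s)]
  have key := integral_mul_deriv_eq_deriv_mul_of_integrable (u := f) (u' := f')
    (v := gaussianPDFReal 0 v) (v' := fun s => -(s / v) * gaussianPDFReal 0 v s)
    (fun x _ => hf x) (fun x _ => aux_hasDerivAt_pdf v hv x) ?_ ?_ ?_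
  · rw [integral_gaussianReal_eq_integral_smul hv, integral_gaussianReal_eq_integral_smul hv]
    simp only [smul_eq_mul]
    have e1 : ∫ x, f x * (-(x / v) * gaussianPDFReal 0 v x) =
        -(v:ℝ)⁻¹ * ∫ x, gaussianPDFReal 0 v x * (x * f x) := by
      rw [← integral_const_mul]; congr 1; ext x; field_simp
    have e2 : ∫ x, f' x * gaussianPDFReal 0 v x = ∫ x, gaussianPDFReal 0 v x * f' x := by
      congr 1; ext x; ring
    rw [e1, e2] at key
    have k2 : (v:ℝ) * (-(v:ℝ)⁻¹ * ∫ x, gaussianPDFReal 0 v x * (x * f x)) =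
      v * (-∫ x, gaussianPDFReal 0 v x * f' x) := by rw [key]
    rw [← mul_assoc, mul_neg, mul_inv_cancel₀ hv'] at k2
    linarith
  · have := (hpid.const_mul (-(v:ℝ)⁻¹)).bdd_mul (c := M) hfc.aestronglyMeasurable
      (Eventually.of_forall fun s => by simpa using hM s)
    refine this.congr (Eventually.of_forall fun s => ?_)
    simp; left; field_simp
  · exact hpi.bdd_mul (c := M') hf'c.aestronglyMeasurable
      (Eventually.of_forall fun s => by simpa using hM' s)
  · exact hpi.bdd_mul (c := M) hfc.aestronglyMeasurable
      (Eventually.of_forall fun s => by simpa using hM s)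

lemma aux_fderiv_sum {I : Type*} [Fintype I] [DecidableEq I] (L : (I → ℝ) →L[ℝ] ℝ) (w : I → ℝ) :
    L w = ∑ x, w x * L (Pi.single x 1) := by
  conv_lhs => rw [← Finset.univ_sum_single w, map_sum]
  refine Finset.sum_congr rfl fun x _ => ?_
  rw [show (Pi.single x (w x) : I → ℝ) = w x • Pi.single x 1 by
    rw [← Pi.single_smul]; simp, map_smul, smul_eq_mul]

lemma aux_integrable_coord {I : Type*} [Fintype I] (μ : Measure (I → ℝ)) [IsGaussian μ] (x : I) :
    Integrable (fun h : I → ℝ => h x) μ :=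
  IsGaussian.integrable_dual μ (ContinuousLinearMap.proj (R := ℝ) (φ := fun _ : I => ℝ) x)

lemma aux_memLp_coord {I : Type*} [Fintype I] (μ : Measure (I → ℝ)) [IsGaussian μ] (x : I) :
    MemLp (fun h : I → ℝ => h x) 2 μ :=
  IsGaussian.memLp_dual μ (ContinuousLinearMap.proj (R := ℝ) (φ := fun _ : I => ℝ) x) 2 (by simp)

/-- Gaussian integration by parts. -/
lemma aux_ibp {I : Type*} [Fintype I] [DecidableEq I] (μ : Measure (I → ℝ)) [IsGaussian μ]
    (C : I → I → ℝ) (hmean : ∀ x, ∫ h, h x ∂μ = 0) (hC : ∀ x y, ∫ h, h x * h y ∂μ = C x y)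
    (y : I) (hy : 0 < C y y) (G : (I → ℝ) → ℝ) (hG : ContDiff ℝ 1 G) (M M' : ℝ)
    (hM : ∀ h, |G h| ≤ M) (hM' : ∀ x h, |fderiv ℝ G h (Pi.single x 1)| ≤ M') :
    ∫ h, h y * G h ∂μ = ∑ x, C x y * ∫ h, fderiv ℝ G h (Pi.single x 1) ∂μ := by
  set b : I → ℝ := fun x => C x y / C y y with hb
  have hGd : ∀ h, HasFDerivAt G (fderiv ℝ G h) h := fun h =>
    (hG.differentiable (by norm_num)).differentiableAt.hasFDerivAt
  have hGdc : Continuous (fderiv ℝ G) := hG.continuous_fderiv (by norm_num)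
  have hGc : Continuous G := hG.continuous
  have hDc : ∀ x, Continuous fun h => fderiv ℝ G h (Pi.single x 1) := fun x => by fun_prop
  have hind : IndepFun (fun (h : I → ℝ) => h y) (fun (h : I → ℝ) => fun x => h x - h y * b x) μ := by
    have hg : HasGaussianLaw (fun h : I → ℝ => (fun (_ : Unit) => h y, fun x => h x - h y * b x)) μ := by
      have := (IsGaussian.hasGaussianLaw_id (μ := μ)).map_fun
        (((ContinuousLinearMap.pi fun (_ : Unit) =>
            (ContinuousLinearMap.proj (R := ℝ) (φ := fun _ : I => ℝ) y))).prod
          (ContinuousLinearMap.pi fun x =>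
            (ContinuousLinearMap.proj (R := ℝ) (φ := fun _ : I => ℝ) x)
            - b x • (ContinuousLinearMap.proj (R := ℝ) (φ := fun _ : I => ℝ) y)))
      refine this.congr (Eventually.of_forall fun h => ?_)
      ext <;> simp [mul_comm]
    have := hg.indepFun_of_covariance_eval (X := fun (_ : Unit) (h : I → ℝ) => h y)
      (Y := fun x (h : I → ℝ) => h x - h y * b x) ?_
    · exact this.comp (φ := fun f : Unit → ℝ => f ()) (ψ := id) (by fun_prop) (by fun_prop)
    · intro _ x
      have m1 := aux_memLp_coord μ y
      have m2 := aux_memLp_coord μ x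
      have m3 : MemLp (fun h : I → ℝ => h y * b x) 2 μ := m1.mul_const _
      have hcs := covariance_eq_sub (μ := μ) m1 (m2.sub m3)
      change cov[fun h : I → ℝ => h y, (fun h : I → ℝ => h x) - fun h : I → ℝ => h y * b x; μ] = 0
      rw [hcs, hmean y, zero_mul, sub_zero]
      have i1 : Integrable (fun h : I → ℝ => h x * h y) μ := m2.integrable_mul m1
      have i2 : Integrable (fun h : I → ℝ => h y * h y) μ := m1.integrable_mul m1
      have : (fun h : I → ℝ => ((fun h : I → ℝ => h y) * ((fun h : I → ℝ => h x) - fun h : I → ℝ => h y * b x)) h)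
        = fun h => h x * h y - (h y * h y) * b x := by ext h; simp; ring
      rw [this, integral_sub i1 (i2.mul_const _), integral_mul_const, hC, hC, hb]
      field_simp; simp
  set Z : (I → ℝ) → (I → ℝ) := fun h => fun x => h x - h y * b x with hZ
  have hZm : Measurable Z := by rw [hZ]; fun_prop
  have hpm : μ.map (fun h => (h y, Z h)) = (μ.map fun h => h y).prod (μ.map Z) :=
    (indepFun_iff_map_prod_eq_prod_map_map (measurable_pi_apply y).aemeasurable hZm.aemeasurable).1 hind
  set v : NNReal := (C y y).toNNReal with hvdef
  have hvr : (v : ℝ) = C y y := by simp [hvdef, hy.le]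
  have hv0 : v ≠ 0 := by simp [hvdef, hy]
  have hlaw : (μ.map fun h : I → ℝ => h y) = gaussianReal 0 v := by
    have hg : HasGaussianLaw (fun h : I → ℝ => h y) μ :=
      (IsGaussian.hasGaussianLaw_id (μ := μ)).map_fun
        (ContinuousLinearMap.proj (R := ℝ) (φ := fun _ : I => ℝ) y)
    rw [hg.map_eq_gaussianReal, hmean y]
    congr 2
    rw [variance_of_integral_eq_zero (measurable_pi_apply y).aemeasurable (hmean y), ← hC y y]
    congr 1; ext h; ring
  have : IsProbabilityMeasure (μ.map Z) := Measure.isProbabilityMeasure_map hZm.aemeasurable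
  -- transfer
  have htrans : ∀ f : ℝ × (I → ℝ) → ℝ, Continuous f → Integrable f ((gaussianReal 0 v).prod (μ.map Z)) →
      ∫ h, f (h y, Z h) ∂μ = ∫ z, ∫ s, f (s, z) ∂(gaussianReal 0 v) ∂(μ.map Z) := by
    intro f hf hfi
    rw [← integral_prod_symm _ hfi, ← hlaw, ← hpm, integral_map (by fun_prop) hf.aestronglyMeasurable]
  have hback : ∀ h : I → ℝ, (Z h + h y • b) = h := by
    intro h; ext x; simp [hZ]
  have hid : Integrable (fun s : ℝ => s) (gaussianReal 0 v) :=
    IsGaussian.integrable_id (μ := gaussianReal 0 v)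
  have hfst : Integrable (fun q : ℝ × (I → ℝ) => q.1) ((gaussianReal 0 v).prod (μ.map Z)) :=
    hid.comp_fst (μ.map Z)
  have h1 := htrans (fun q => q.1 * G (q.2 + q.1 • b)) (by fun_prop)
    (hfst.mul_bdd (c := M) (by fun_prop) (Eventually.of_forall fun s => by simpa using hM _))
  have hstein : ∀ z, ∫ s, s * G (z + s • b) ∂(gaussianReal 0 v)
      = v * ∫ s, ∑ x, b x * fderiv ℝ G (z + s • b) (Pi.single x 1) ∂(gaussianReal 0 v) := by
    intro z
    refine aux_stein v hv0 _ _ (fun s => ?_) (by fun_prop) M (∑ x, |b x| * M') (fun s => hM _)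
      (fun s => ?_)
    · rw [← aux_fderiv_sum]
      have hl : HasDerivAt (fun s : ℝ => z + s • b) b s := by
        simpa using ((hasDerivAt_id s).smul_const b).const_add z
      exact (hGd _).comp_hasDerivAt s hl
    · refine (Finset.abs_sum_le_sum_abs _ _).trans (Finset.sum_le_sum fun x _ => ?_)
      rw [abs_mul]
      exact mul_le_mul_of_nonneg_left (hM' _ _) (abs_nonneg _)
  have h2 : ∀ x, ∫ h, fderiv ℝ G h (Pi.single x 1) ∂μ =
      ∫ z, ∫ s, fderiv ℝ G (z + s • b) (Pi.single x 1) ∂(gaussianReal 0 v) ∂(μ.map Z) := by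
    intro x
    have := htrans (fun q => fderiv ℝ G (q.2 + q.1 • b) (Pi.single x 1)) (by fun_prop)
      (Integrable.of_bound (C := M') (by fun_prop) (Eventually.of_forall fun s => by simpa using hM' x _))
    simpa [hback] using this
  simp only [hback] at h1
  rw [h1]
  simp only [hstein]
  rw [integral_const_mul, hvr]
  have h3 : ∀ z, ∫ s, ∑ x, b x * fderiv ℝ G (z + s • b) (Pi.single x 1) ∂(gaussianReal 0 v)
      = ∑ x, b x * ∫ s, fderiv ℝ G (z + s • b) (Pi.single x 1) ∂(gaussianReal 0 v) := by
    intro z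
    rw [integral_finsetSum]
    · simp [integral_const_mul]
    · intro x _
      exact (Integrable.of_bound (C := M') (by fun_prop)
        (Eventually.of_forall fun s => by simpa using hM' x _)).const_mul _
  simp only [h3]
  rw [integral_finsetSum]
  · rw [Finset.mul_sum]
    refine Finset.sum_congr rfl fun x _ => ?_
    rw [integral_const_mul, h2 x, hb]
    field_simp
  · intro x _
    refine Integrable.const_mul ?_ _
    refine Integrable.of_bound (C := M') ?_ (Eventually.of_forall fun z => ?_)
    · refine (StronglyMeasurable.integral_prod_left' (μ := gaussianReal 0 v)
        (f := fun q : ℝ × (I → ℝ) => fderiv ℝ G (q.2 + q.1 • b) (Pi.single x 1)) ?_).aestronglyMeasurable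
      exact Continuous.stronglyMeasurable (by fun_prop)
    · have := norm_integral_le_of_norm_le_const (μ := gaussianReal 0 v) (C := M')
        (f := fun s => fderiv ℝ G (z + s • b) (Pi.single x 1))
        (Eventually.of_forall fun s => by simpa using hM' x _)
      simpa using this

end

section

open MeasureTheory ProbabilityTheory Filter Real Finset

/-- Gaussian interpolation bound for a variance. -/
lemma aux_var {I : Type*} [Fintype I] [DecidableEq I] (μ : Measure (I → ℝ)) [IsGaussian μ]
    (C : I → I → ℝ) (hmean : ∀ x, ∫ h, h x ∂μ = 0) (hC : ∀ x y, ∫ h, h x * h y ∂μ = C x y)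
    (hpos : ∀ y, 0 < C y y) (Ψ : (I → ℝ) → ℝ) (hΨ : ContDiff ℝ 1 Ψ) (hΨ1 : ∀ h, |Ψ h| ≤ 1)
    (g : ℝ → ℝ) (hgc : Continuous g) (hg0 : ∀ s, 0 ≤ g s) (M : ℝ) (hgM : ∀ s, g s ≤ M)
    (hD : ∀ x h, |fderiv ℝ Ψ h (Pi.single x 1)| ≤ g (h x)) (κ : I → I → ℝ)
    (hκ : ∀ x y, ∀ θ ∈ Set.Icc 0 (π / 2), Real.sin θ *
      ∫ w, g (w.1 y) * g (Real.cos θ * w.1 x - Real.sin θ * w.2 x) ∂(μ.prod μ) ≤ κ x y) :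
    ∫ h, Ψ h ^ 2 ∂μ - (∫ h, Ψ h ∂μ) ^ 2 ≤ (∑ y, ∑ x, |C x y| * κ x y) * (π / 2) := by
  have hM0 : 0 ≤ M := (hg0 0).trans (hgM 0)
  have hΨd : ∀ h, HasFDerivAt Ψ (fderiv ℝ Ψ h) h := fun h =>
    (hΨ.differentiable (by norm_num)).differentiableAt.hasFDerivAt
  have hΨdc : Continuous (fderiv ℝ Ψ) := hΨ.continuous_fderiv (by norm_num)
  have hΨc : Continuous Ψ := hΨ.continuous
  have hDM : ∀ h w, |fderiv ℝ Ψ h w| ≤ ∑ y, |w y| * M := by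
    intro h w
    rw [aux_fderiv_sum]
    refine (Finset.abs_sum_le_sum_abs _ _).trans (Finset.sum_le_sum fun x _ => ?_)
    rw [abs_mul]
    exact mul_le_mul_of_nonneg_left ((hD x h).trans (hgM _)) (abs_nonneg _)
  have hc1 : ∀ y, Integrable (fun z : (I → ℝ) × (I → ℝ) => z.1 y) (μ.prod μ) := fun y =>
    (aux_integrable_coord μ y).comp_fst μ
  have hc2 : ∀ y, Integrable (fun z : (I → ℝ) × (I → ℝ) => z.2 y) (μ.prod μ) := fun y =>
    (aux_integrable_coord μ y).comp_snd μ
  set ψ : ℝ → ℝ := fun θ => ∫ z, Ψ z.1 * Ψ (cos θ • z.1 + sin θ • z.2) ∂(μ.prod μ) with hψ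
  set ψ' : ℝ → ℝ := fun θ => ∫ z, Ψ z.1 * fderiv ℝ Ψ (cos θ • z.1 + sin θ • z.2)
    (-sin θ • z.1 + cos θ • z.2) ∂(μ.prod μ) with hψ'
  have hder : ∀ θ, HasDerivAt ψ (ψ' θ) θ := by
    intro θ
    refine (hasDerivAt_integral_of_dominated_loc_of_deriv_le (𝕜 := ℝ) (E := ℝ) (s := Set.univ)
      (μ := μ.prod μ) (x₀ := θ)
      (F := fun θ z => Ψ z.1 * Ψ (cos θ • z.1 + sin θ • z.2))
      (F' := fun θ z => Ψ z.1 * fderiv ℝ Ψ (cos θ • z.1 + sin θ • z.2)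
        (-sin θ • z.1 + cos θ • z.2))
      (bound := fun z : (I → ℝ) × (I → ℝ) => ∑ y, (|z.1 y| + |z.2 y|) * M) univ_mem ?_ ?_ ?_ ?_ ?_ ?_).2
    · refine Eventually.of_forall fun θ => Continuous.aestronglyMeasurable (by fun_prop)
    · refine Integrable.of_bound (C := 1) (Continuous.aestronglyMeasurable (by fun_prop))
        (Eventually.of_forall fun z => ?_)
      rw [norm_mul]
      exact mul_le_one₀ (hΨ1 _) (norm_nonneg _) (hΨ1 _)
    · exact Continuous.aestronglyMeasurable (by fun_prop)
    · refine Eventually.of_forall fun z θ _ => ?_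
      rw [norm_mul]
      refine (mul_le_of_le_one_left (norm_nonneg _) (hΨ1 _)).trans ((hDM _ _).trans ?_)
      refine Finset.sum_le_sum fun y _ => mul_le_mul_of_nonneg_right ?_ hM0
      simp only [Pi.add_apply, Pi.smul_apply, smul_eq_mul]
      refine (abs_add_le _ _).trans ?_
      rw [abs_mul, abs_mul, abs_neg]
      exact add_le_add (mul_le_of_le_one_left (abs_nonneg _) (abs_sin_le_one _))
        (mul_le_of_le_one_left (abs_nonneg _) (abs_cos_le_one _))
    · exact integrable_finsetSum _ fun y _ => ((hc1 y).abs.add (hc2 y).abs).mul_const _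
    · refine Eventually.of_forall fun z θ _ => ?_
      refine HasDerivAt.const_mul _ ?_
      refine (hΨd _).comp_hasDerivAt θ ?_
      exact ((hasDerivAt_cos θ).smul_const z.1).add ((hasDerivAt_sin θ).smul_const z.2)
  have hmean' : ∫ h, id h ∂μ = 0 := by
    ext x
    have := ContinuousLinearMap.integral_comp_comm
      (ContinuousLinearMap.proj (R := ℝ) (φ := fun _ : I => ℝ) x) (IsGaussian.integrable_id (μ := μ))
    simp only [ContinuousLinearMap.proj_apply, id] at this
    simp only [id]
    rw [← this, hmean]; rfl
  have hbound : ∀ θ ∈ Set.Icc 0 (π / 2), |ψ' θ| ≤ ∑ y, ∑ x, |C x y| * κ x y := by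
    intro θ hθ
    have hs0 : 0 ≤ sin θ := sin_nonneg_of_nonneg_of_le_pi hθ.1 (hθ.2.trans (by linarith [pi_pos]))
    set K : (I → ℝ) × (I → ℝ) → ℝ := fun w => Ψ (cos θ • w.1 - sin θ • w.2) * fderiv ℝ Ψ w.1 w.2
      with hK
    have hKc : Continuous K := by rw [hK]; fun_prop
    have e1 : ψ' θ = ∫ w, K w ∂(μ.prod μ) := by
      conv_rhs => rw [← IsGaussian.map_rotation_eq_self hmean' θ]
      rw [integral_map (by fun_prop) hKc.aestronglyMeasurable]
      refine integral_congr_ae (Eventually.of_forall fun z => ?_)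
      simp only [hK, ContinuousLinearMap.rotation_apply]
      congr 2
      have : cos θ • (cos θ • z.1 + sin θ • z.2) - sin θ • (-sin θ • z.1 + cos θ • z.2)
          = (cos θ ^ 2 + sin θ ^ 2) • z.1 := by module
      rw [this, cos_sq_add_sin_sq, one_smul]
    have hKi : Integrable K (μ.prod μ) := by
      refine Integrable.mono' (g := fun z => ∑ y, |z.2 y| * M)
        (integrable_finsetSum _ fun y _ => (hc2 y).abs.mul_const _) hKc.aestronglyMeasurable
        (Eventually.of_forall fun z => ?_)
      rw [hK, norm_mul]
      exact (mul_le_of_le_one_left (norm_nonneg _) (hΨ1 _)).trans (hDM _ _)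
    rw [e1, integral_prod _ hKi]
    have hInner : ∀ a, ∫ b, K (a, b) ∂μ = ∑ y, fderiv ℝ Ψ a (Pi.single y 1) *
        ∑ x, C x y * ∫ b, -sin θ * fderiv ℝ Ψ (cos θ • a - sin θ • b) (Pi.single x 1) ∂μ := by
      intro a
      have hGc : ContDiff ℝ 1 fun b : I → ℝ => Ψ (cos θ • a - sin θ • b) := by fun_prop
      have hGd : ∀ b w, fderiv ℝ (fun b : I → ℝ => Ψ (cos θ • a - sin θ • b)) b w
          = -sin θ * fderiv ℝ Ψ (cos θ • a - sin θ • b) w := by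
        intro b w
        have hl : HasFDerivAt (fun b : I → ℝ => cos θ • a - sin θ • b)
            (-(sin θ • ContinuousLinearMap.id ℝ (I → ℝ))) b :=
          ((hasFDerivAt_id b).const_smul (sin θ)).const_sub (cos θ • a)
        have hcomp : HasFDerivAt (fun b : I → ℝ => Ψ (cos θ • a - sin θ • b)) _ b := (hΨd _).comp b hl
        rw [hcomp.fderiv]
        simp
      have hibp := fun y => aux_ibp μ C hmean hC y (hpos y) _ hGc 1 M (fun h => hΨ1 _) (fun x h => by
        rw [hGd, abs_mul, abs_neg]
        exact (mul_le_of_le_one_left (abs_nonneg _) (abs_sin_le_one _)).trans ((hD _ _).trans (hgM _)))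
      simp only [hGd] at hibp
      simp only [← hibp]
      simp only [← integral_const_mul]
      rw [← integral_finsetSum]
      · refine integral_congr_ae (Eventually.of_forall fun b => ?_)
        simp only [hK]
        rw [aux_fderiv_sum, Finset.mul_sum]
        refine Finset.sum_congr rfl fun y _ => by ring
      · intro y _
        refine Integrable.const_mul ?_ _
        exact (aux_integrable_coord μ y).mul_bdd (c := 1)
          (Continuous.aestronglyMeasurable (by fun_prop)) (Eventually.of_forall fun b => hΨ1 _)
    simp only [hInner]
    have hgi : ∀ x y, Integrable (fun w : (I → ℝ) × (I → ℝ) =>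
        g (w.1 y) * g (Real.cos θ * w.1 x - Real.sin θ * w.2 x)) (μ.prod μ) := by
      intro x y
      refine Integrable.of_bound (C := M * M) (Continuous.aestronglyMeasurable (by fun_prop))
        (Eventually.of_forall fun w => ?_)
      rw [norm_mul, Real.norm_of_nonneg (hg0 _), Real.norm_of_nonneg (hg0 _)]
      exact mul_le_mul (hgM _) (hgM _) (hg0 _) hM0
    have hle := norm_integral_le_of_norm_le (μ := μ)
      (f := fun a => ∑ y, fderiv ℝ Ψ a (Pi.single y 1) *
        ∑ x, C x y * ∫ b, -sin θ * fderiv ℝ Ψ (cos θ • a - sin θ • b) (Pi.single x 1) ∂μ)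
      (g := fun a => ∑ y, ∑ x, |C x y| * (sin θ *
        ∫ b, g (a y) * g (Real.cos θ * a x - Real.sin θ * b x) ∂μ)) ?_ ?_
    · refine hle.trans ?_
      rw [integral_finsetSum]
      swap
      · intro y _
        exact integrable_finsetSum _ fun x _ => ((hgi x y).integral_prod_left.const_mul _).const_mul _
      refine Finset.sum_le_sum fun y _ => ?_
      rw [integral_finsetSum]
      swap
      · intro x _
        exact ((hgi x y).integral_prod_left.const_mul _).const_mul _
      refine Finset.sum_le_sum fun x _ => ?_
      rw [integral_const_mul, integral_const_mul, ← integral_prod _ (hgi x y)]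
      exact mul_le_mul_of_nonneg_left (hκ x y θ hθ) (abs_nonneg _)
    · exact integrable_finsetSum _ fun y _ => integrable_finsetSum _ fun x _ =>
        ((hgi x y).integral_prod_left.const_mul _).const_mul _
    · refine Eventually.of_forall fun a => ?_
      refine (Finset.abs_sum_le_sum_abs _ _).trans (Finset.sum_le_sum fun y _ => ?_)
      rw [abs_mul]
      calc _ ≤ g (a y) * ∑ x, |C x y| * (sin θ * ∫ b, g (Real.cos θ * a x - Real.sin θ * b x) ∂μ) := by
            refine mul_le_mul (hD _ _) ?_ (abs_nonneg _) (hg0 _)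
            refine (Finset.abs_sum_le_sum_abs _ _).trans (Finset.sum_le_sum fun x _ => ?_)
            rw [abs_mul, integral_const_mul, abs_mul, abs_neg, abs_of_nonneg hs0]
            refine mul_le_mul_of_nonneg_left (mul_le_mul_of_nonneg_left ?_ hs0) (abs_nonneg _)
            rw [← Real.norm_eq_abs]
            refine norm_integral_le_of_norm_le ?_ (Eventually.of_forall fun b => ?_)
            · refine Integrable.of_bound (C := M) (Continuous.aestronglyMeasurable (by fun_prop))
                (Eventually.of_forall fun w => ?_)
              rw [Real.norm_of_nonneg (hg0 _)]; exact hgM _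
            · simpa using hD x (cos θ • a - sin θ • b)
        _ = _ := by
            rw [Finset.mul_sum]
            refine Finset.sum_congr rfl fun x _ => ?_
            rw [integral_const_mul]; ring
  have hfin := norm_image_sub_le_of_norm_deriv_le_segment' (f := ψ) (f' := ψ') (a := 0) (b := π / 2)
    (C := ∑ y, ∑ x, |C x y| * κ x y) (fun θ _ => (hder θ).hasDerivWithinAt)
    (fun θ hθ => hbound θ ⟨hθ.1, hθ.2.le⟩) (π / 2) ⟨by positivity, le_rfl⟩
  have e0 : ψ 0 = ∫ h, Ψ h ^ 2 ∂μ := by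
    simp only [hψ, cos_zero, sin_zero, one_smul, zero_smul, add_zero]
    rw [integral_fun_fst (μ := μ) (ν := μ) (fun h => Ψ h * Ψ h)]
    simp [sq]
  have e1 : ψ (π / 2) = (∫ h, Ψ h ∂μ) ^ 2 := by
    simp only [hψ, cos_pi_div_two, sin_pi_div_two, one_smul, zero_smul, zero_add]
    rw [integral_prod_mul (μ := μ) (ν := μ) Ψ Ψ, sq]
  rw [e0, e1, sub_zero] at hfin
  have := abs_le.1 hfin
  linarith [this.1]

end

section

open MeasureTheory ProbabilityTheory Filter Real Finset

lemma MeasureTheory.Integrable.aux_isub {α : Type*} [MeasurableSpace α] {μ : Measure α} {f g : α → ℝ}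
    (hf : Integrable f μ) (hg : Integrable g μ) : Integrable (fun a => f a - g a) μ := hf.sub hg

lemma aux_quad (v ρ r m s y : ℝ) (hv : 0 < v) (hρ : ρ ^ 2 < 1) (hr : |ρ| ≤ r) :
    m ^ 2 / (v * (1 + r)) + m / (v * (1 + r)) * (s - m) + m / (v * (1 + r)) * (y - m) ≤
      s ^ 2 / (2 * v) + (y - ρ * s) ^ 2 / (2 * (v * (1 - ρ ^ 2))) := by
  have h1 : ρ < 1 := by nlinarith
  have h2 : -1 < ρ := by nlinarith
  have h3 : ρ ≤ r := (le_abs_self _).trans hr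
  have e : s ^ 2 / (2 * v) + (y - ρ * s) ^ 2 / (2 * (v * (1 - ρ ^ 2)))
      = (s + y) ^ 2 / (4 * v * (1 + ρ)) + (s - y) ^ 2 / (4 * v * (1 - ρ)) := by
    have a1 : 1 + ρ ≠ 0 := by linarith
    have a2 : 1 - ρ ≠ 0 := by linarith
    have a3 : 1 - ρ ^ 2 = (1 + ρ) * (1 - ρ) := by ring
    rw [a3]
    field_simp
    ring
  rw [e]
  have h4 : (s + y) ^ 2 / (4 * v * (1 + r)) ≤ (s + y) ^ 2 / (4 * v * (1 + ρ)) := by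
    apply div_le_div_of_nonneg_left (sq_nonneg _)
    · have : 0 < 1 + ρ := by linarith
      positivity
    · nlinarith
  have h5 : 0 ≤ (s - y) ^ 2 / (4 * v * (1 - ρ)) := by
    have : 0 < 1 - ρ := by linarith
    positivity
  have h6 : m ^ 2 / (v * (1 + r)) + m / (v * (1 + r)) * (s - m) + m / (v * (1 + r)) * (y - m)
      ≤ (s + y) ^ 2 / (4 * v * (1 + r)) := by
    have hr0 : 0 < 1 + r := by linarith
    have : (s + y) ^ 2 / (4 * v * (1 + r)) - (m ^ 2 / (v * (1 + r)) + m / (v * (1 + r)) * (s - m) + m / (v * (1 + r)) * (y - m)) = (s + y - 2 * m) ^ 2 / (4 * v * (1 + r)) := by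
      field_simp
      ring
    have : 0 ≤ (s + y - 2 * m) ^ 2 / (4 * v * (1 + r)) := by positivity
    linarith
  linarith

lemma aux_biv {I : Type*} [Fintype I] [DecidableEq I] (μ : Measure (I → ℝ)) [IsGaussian μ]
    (C : I → I → ℝ) (hmean : ∀ x, ∫ h, h x ∂μ = 0) (hC : ∀ x y, ∫ h, h x * h y ∂μ = C x y)
    (v : ℝ) (hv : 0 < v) (hCv : ∀ x, C x x = v)
    (g : ℝ → ℝ) (hgc : Continuous g) (hg0 : ∀ s, 0 ≤ g s) (M : ℝ) (hgM : ∀ s, g s ≤ M)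
    (x y : I) (r : ℝ) (hr : |C x y| = v * r) (hr1 : r ≤ 1) (m : ℝ)
    (hi : Integrable (fun s => g s * rexp (-(m / (v * (1 + r)) * (s - m)))))
    (T : ℝ) (hi2 : ∫ s, g s * rexp (-(m / (v * (1 + r)) * (s - m))) ≤ T)
    (θ : ℝ) (hθ : θ ∈ Set.Icc 0 (π / 2)) :
    Real.sin θ *
      ∫ w, g (w.1 y) * g (Real.cos θ * w.1 x - Real.sin θ * w.2 x) ∂(μ.prod μ) ≤
      (2 * π * v)⁻¹ * rexp (-(m ^ 2 / (v * (1 + r)))) * T ^ 2 := by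
  have hs0 : 0 ≤ sin θ := sin_nonneg_of_nonneg_of_le_pi hθ.1 (hθ.2.trans (by linarith [pi_pos]))
  rcases hs0.eq_or_lt with hs | hs
  · rw [← hs, zero_mul]; positivity
  set L := m / (v * (1 + r)) with hL
  set ρ := cos θ * (C x y / v) with hρ
  have hr0 : 0 ≤ r := by
    by_contra h
    have := abs_nonneg (C x y)
    nlinarith
  have hCr : |C x y / v| = r := by rw [abs_div, hr, abs_of_pos hv]; field_simp
  have hρr : |ρ| ≤ r := by
    rw [hρ, abs_mul, hCr]
    exact mul_le_of_le_one_left hr0 (abs_cos_le_one _)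
  have hρs : sin θ ^ 2 ≤ 1 - ρ ^ 2 := by
    have h1 : ρ ^ 2 = cos θ ^ 2 * r ^ 2 := by rw [hρ, mul_pow, ← sq_abs (C x y / v), hCr]
    have h2 := sin_sq_add_cos_sq θ
    have h3 : r ^ 2 ≤ 1 := by nlinarith
    nlinarith [sq_nonneg (cos θ)]
  have hρ1 : ρ ^ 2 < 1 := by nlinarith
  have hρv : ρ * v = cos θ * C x y := by rw [hρ]; field_simp
  -- independence
  have m1 : ∀ z, MemLp (fun w : (I → ℝ) × (I → ℝ) => w.1 z) 2 (μ.prod μ) := fun z =>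
    (aux_memLp_coord μ z).comp_fst μ
  have m2 : ∀ z, MemLp (fun w : (I → ℝ) × (I → ℝ) => w.2 z) 2 (μ.prod μ) := fun z =>
    (aux_memLp_coord μ z).comp_snd μ
  set U : (I → ℝ) × (I → ℝ) → ℝ := fun w => w.1 y with hU
  set W : (I → ℝ) × (I → ℝ) → ℝ := fun w => cos θ * w.1 x - sin θ * w.2 x - ρ * w.1 y with hW
  have hUm : Measurable U := by rw [hU]; fun_prop
  have hWm : Measurable W := by rw [hW]; fun_prop
  have hg : HasGaussianLaw (fun w => (U w, W w)) (μ.prod μ) := by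
    let P1 : I → ((I → ℝ) × (I → ℝ)) →L[ℝ] ℝ := fun z =>
      (ContinuousLinearMap.proj (R := ℝ) (φ := fun _ : I => ℝ) z).comp (ContinuousLinearMap.fst ℝ _ _)
    let P2 : I → ((I → ℝ) × (I → ℝ)) →L[ℝ] ℝ := fun z =>
      (ContinuousLinearMap.proj (R := ℝ) (φ := fun _ : I => ℝ) z).comp (ContinuousLinearMap.snd ℝ _ _)
    have := (IsGaussian.hasGaussianLaw_id (μ := μ.prod μ)).map_fun
        ((P1 y).prod (cos θ • P1 x - sin θ • P2 x - ρ • P1 y))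
    refine this.congr (Eventually.of_forall fun h => ?_)
    simp [P1, P2, hU, hW]
  have hWL : MemLp W 2 (μ.prod μ) :=
    (((m1 x).const_mul (cos θ)).sub ((m2 x).const_mul (sin θ))).sub ((m1 y).const_mul ρ)
  have I11 : ∀ a b, ∫ w : (I → ℝ) × (I → ℝ), w.1 a * w.1 b ∂(μ.prod μ) = C a b := by
    intro a b
    rw [integral_fun_fst (μ := μ) (ν := μ) (fun h => h a * h b), hC]; simp
  have I22 : ∀ a b, ∫ w : (I → ℝ) × (I → ℝ), w.2 a * w.2 b ∂(μ.prod μ) = C a b := by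
    intro a b
    rw [integral_fun_snd (μ := μ) (ν := μ) (fun h => h a * h b), hC]; simp
  have I12 : ∀ a b, ∫ w : (I → ℝ) × (I → ℝ), w.1 a * w.2 b ∂(μ.prod μ) = 0 := by
    intro a b
    rw [integral_prod_mul (μ := μ) (ν := μ) (fun h => h a) (fun h => h b), hmean]; simp
  have J11 : ∀ a b, Integrable (fun w : (I → ℝ) × (I → ℝ) => w.1 a * w.1 b) (μ.prod μ) :=
    fun a b => (m1 a).integrable_mul (m1 b)
  have J12 : ∀ a b, Integrable (fun w : (I → ℝ) × (I → ℝ) => w.1 a * w.2 b) (μ.prod μ) :=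
    fun a b => (m1 a).integrable_mul (m2 b)
  have J22 : ∀ a b, Integrable (fun w : (I → ℝ) × (I → ℝ) => w.2 a * w.2 b) (μ.prod μ) :=
    fun a b => (m2 a).integrable_mul (m2 b)
  have EU : ∫ w, U w ∂(μ.prod μ) = 0 := by
    rw [hU, integral_fun_fst (μ := μ) (ν := μ) (fun h => h y), hmean]; simp
  have E1 : ∀ z, ∫ w : (I → ℝ) × (I → ℝ), w.1 z ∂(μ.prod μ) = 0 := fun z => by
    rw [integral_fun_fst (μ := μ) (ν := μ) (fun h => h z), hmean]; simp
  have E2 : ∀ z, ∫ w : (I → ℝ) × (I → ℝ), w.2 z ∂(μ.prod μ) = 0 := fun z => by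
    rw [integral_fun_snd (μ := μ) (ν := μ) (fun h => h z), hmean]; simp
  have i1 : ∀ z, Integrable (fun w : (I → ℝ) × (I → ℝ) => w.1 z) (μ.prod μ) := fun z =>
    (m1 z).integrable (by norm_num)
  have i2 : ∀ z, Integrable (fun w : (I → ℝ) × (I → ℝ) => w.2 z) (μ.prod μ) := fun z =>
    (m2 z).integrable (by norm_num)
  have EW : ∫ w, W w ∂(μ.prod μ) = 0 := by
    simp only [hW]
    rw [integral_sub (((i1 x).const_mul _).aux_isub ((i2 x).const_mul _)) ((i1 y).const_mul _),
      integral_sub ((i1 x).const_mul _) ((i2 x).const_mul _), integral_const_mul,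
      integral_const_mul, integral_const_mul, E1, E1, E2]; simp
  have EUW : ∫ w, U w * W w ∂(μ.prod μ) = 0 := by
    have : (fun w => U w * W w) = fun w : (I → ℝ) × (I → ℝ) => cos θ * (w.1 x * w.1 y) - sin θ * (w.1 y * w.2 x)
      - ρ * (w.1 y * w.1 y) := by ext w; simp [hU, hW]; ring
    rw [this, integral_sub (((J11 x y).const_mul _).aux_isub ((J12 y x).const_mul _))
      ((J11 y y).const_mul _), integral_sub ((J11 x y).const_mul _) ((J12 y x).const_mul _),
      integral_const_mul, integral_const_mul, integral_const_mul, I11, I11, I12, hCv, hρv]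
    ring
  have EWW : ∫ w, W w ^ 2 ∂(μ.prod μ) = v * (1 - ρ ^ 2) := by
    have : (fun w => W w ^ 2) = fun w : (I → ℝ) × (I → ℝ) =>
      cos θ ^ 2 * (w.1 x * w.1 x) + sin θ ^ 2 * (w.2 x * w.2 x) + ρ ^ 2 * (w.1 y * w.1 y)
      - (2 * cos θ * sin θ) * (w.1 x * w.2 x) - (2 * ρ * cos θ) * (w.1 x * w.1 y)
      + (2 * ρ * sin θ) * (w.1 y * w.2 x) := by ext w; simp [hW]; ring
    have k1 := (J11 x x).const_mul (cos θ ^ 2)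
    have k2 := (J22 x x).const_mul (sin θ ^ 2)
    have k3 := (J11 y y).const_mul (ρ ^ 2)
    have k4 := (J12 x x).const_mul (2 * cos θ * sin θ)
    have k5 := (J11 x y).const_mul (2 * ρ * cos θ)
    have k6 := (J12 y x).const_mul (2 * ρ * sin θ)
    rw [this, integral_add ((((k1.fun_add k2).fun_add k3).aux_isub k4).aux_isub k5) k6,
      integral_sub (((k1.fun_add k2).fun_add k3).aux_isub k4) k5, integral_sub ((k1.fun_add k2).fun_add k3) k4,
      integral_add (k1.fun_add k2) k3, integral_add k1 k2]
    simp only [integral_const_mul, I11, I12, I22, hCv]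
    have : 2 * ρ * cos θ * C x y = 2 * ρ * (ρ * v) := by rw [hρv]; ring
    rw [this]
    linear_combination v * sin_sq_add_cos_sq θ
  have hind : IndepFun U W (μ.prod μ) := by
    refine hg.indepFun_of_covariance_eq_zero ?_
    rw [covariance_eq_sub (m1 y) hWL, EW, mul_zero, sub_zero]
    exact EUW
  have hpm : (μ.prod μ).map (fun h => (U h, W h)) = ((μ.prod μ).map U).prod ((μ.prod μ).map W) :=
    (indepFun_iff_map_prod_eq_prod_map_map hUm.aemeasurable hWm.aemeasurable).1 hind
  set v1 : NNReal := v.toNNReal with hv1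
  set v2 : NNReal := (v * (1 - ρ ^ 2)).toNNReal with hv2
  have hσ : 0 < v * (1 - ρ ^ 2) := mul_pos hv (by linarith)
  have hv1r : (v1 : ℝ) = v := by simp [hv1, hv.le]
  have hv2r : (v2 : ℝ) = v * (1 - ρ ^ 2) := by rw [hv2, Real.coe_toNNReal _ hσ.le]
  have hv10 : v1 ≠ 0 := by simp [hv1, hv]
  have hv20 : v2 ≠ 0 := by simpa [hv2] using hσ
  have lawU : (μ.prod μ).map U = gaussianReal 0 v1 := by
    rw [hg.fst.map_eq_gaussianReal, EU]
    congr 2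
    rw [variance_of_integral_eq_zero hUm.aemeasurable EU, ← hCv y, ← I11 y y]
    congr 1; ext h; simp [hU]; ring
  have lawW : (μ.prod μ).map W = gaussianReal 0 v2 := by
    rw [hg.snd.map_eq_gaussianReal, EW]
    congr 2
    rw [variance_of_integral_eq_zero hWm.aemeasurable EW, ← EWW]
  rw [lawU, lawW] at hpm
  have hgi : Integrable (fun q : ℝ × ℝ => g q.1 * g (ρ * q.1 + q.2))
      ((gaussianReal 0 v1).prod (gaussianReal 0 v2)) := by
    refine Integrable.of_bound (C := M * M) (Continuous.aestronglyMeasurable (by fun_prop))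
        (Eventually.of_forall fun w => ?_)
    rw [norm_mul, Real.norm_of_nonneg (hg0 _), Real.norm_of_nonneg (hg0 _)]
    exact mul_le_mul (hgM _) (hgM _) (hg0 _) ((hg0 0).trans (hgM 0))
  have e1 : ∫ w, g (w.1 y) * g (Real.cos θ * w.1 x - Real.sin θ * w.2 x) ∂(μ.prod μ)
      = ∫ s, g s * ∫ τ, g (ρ * s + τ) ∂(gaussianReal 0 v2) ∂(gaussianReal 0 v1) := by
    have : ∫ w, g (w.1 y) * g (Real.cos θ * w.1 x - Real.sin θ * w.2 x) ∂(μ.prod μ)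
      = ∫ q, g q.1 * g (ρ * q.1 + q.2) ∂((μ.prod μ).map (fun h => (U h, W h))) := by
      rw [integral_map (hUm.prodMk hWm).aemeasurable (Continuous.aestronglyMeasurable (by fun_prop))]
      congr 1; ext w; simp [hU, hW]
    rw [this, hpm, integral_prod _ hgi]
    simp only [integral_const_mul]
  set c2 := (√(2 * π * v2))⁻¹ with hc2
  set c1 := (√(2 * π * v1))⁻¹ with hc1
  set E := rexp (-(m ^ 2 / (v * (1 + r)))) with hE
  have e2 : ∀ s, ∫ τ, g (ρ * s + τ) ∂(gaussianReal 0 v2) =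
      ∫ τ, gaussianPDFReal 0 v2 (τ - ρ * s) * g τ := by
    intro s
    rw [integral_gaussianReal_eq_integral_smul hv20]
    simp only [smul_eq_mul]
    rw [← integral_add_left_eq_self (fun τ => gaussianPDFReal 0 v2 (τ - ρ * s) * g τ) (ρ * s)]
    simp
  have e3 : ∀ s τ, gaussianPDFReal 0 v1 s * gaussianPDFReal 0 v2 (τ - ρ * s) ≤
      (c1 * c2 * E) * (rexp (-(L * (s - m))) * rexp (-(L * (τ - m)))) := by
    intro s τ
    simp only [gaussianPDFReal, ← hc1, ← hc2]
    have : c1 * rexp (-(s - 0) ^ 2 / (2 * v1)) * (c2 * rexp (-(τ - ρ * s - 0) ^ 2 / (2 * v2)))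
      = c1 * c2 * (rexp (-(s ^ 2 / (2 * v) + (τ - ρ * s) ^ 2 / (2 * (v * (1 - ρ ^ 2)))))) := by
      rw [neg_add, exp_add, hv1r, hv2r]; simp only [sub_zero, neg_div]; ring
    rw [this, hE, mul_assoc (c1 * c2), ← exp_add, ← exp_add]
    refine mul_le_mul_of_nonneg_left (exp_le_exp.2 ?_) (by positivity)
    have := aux_quad v ρ r m s τ hv hρ1 hρr
    rw [← hL] at this
    linarith
  have hT0 : 0 ≤ T := le_trans (integral_nonneg fun s => mul_nonneg (hg0 s) (exp_pos _).le) hi2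
  have e4 : ∫ w, g (w.1 y) * g (Real.cos θ * w.1 x - Real.sin θ * w.2 x) ∂(μ.prod μ)
      ≤ c1 * c2 * E * T * T := by
    rw [e1, integral_gaussianReal_eq_integral_smul hv10]
    simp only [smul_eq_mul, e2]
    calc _ ≤ ∫ s, (c1 * c2 * E * T) * (g s * rexp (-(L * (s - m)))) := by
          refine integral_mono_of_nonneg (Eventually.of_forall fun s => ?_) (hi.const_mul _)
            (Eventually.of_forall fun s => ?_)
          · exact mul_nonneg (gaussianPDFReal_nonneg _ _ _) (mul_nonneg (hg0 _)
              (integral_nonneg fun τ => mul_nonneg (gaussianPDFReal_nonneg _ _ _) (hg0 _)))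
          · simp only
            calc gaussianPDFReal 0 v1 s * (g s * ∫ τ, gaussianPDFReal 0 v2 (τ - ρ * s) * g τ)
                = ∫ τ, (g s * (gaussianPDFReal 0 v1 s * gaussianPDFReal 0 v2 (τ - ρ * s))) * g τ := by
                  rw [← mul_assoc, ← integral_const_mul]; congr 1; ext τ; ring
              _ ≤ ∫ τ, (c1 * c2 * E * (g s * rexp (-(L * (s - m))))) * (g τ * rexp (-(L * (τ - m)))) := by
                  refine integral_mono_of_nonneg (Eventually.of_forall fun τ => ?_) (hi.const_mul _)
                    (Eventually.of_forall fun τ => ?_)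
                  · exact mul_nonneg (mul_nonneg (hg0 _) (mul_nonneg (gaussianPDFReal_nonneg _ _ _)
                      (gaussianPDFReal_nonneg _ _ _))) (hg0 _)
                  · simp only
                    have := mul_le_mul_of_nonneg_left (e3 s τ) (mul_nonneg (hg0 s) (hg0 τ))
                    linarith
              _ ≤ _ := by
                  rw [integral_const_mul]
                  have hn : 0 ≤ c1 * c2 * E * (g s * rexp (-(L * (s - m)))) := by
                    have := hg0 s
                    positivity
                  have := mul_le_mul_of_nonneg_left hi2 hn
                  linarith
      _ ≤ _ := by
          rw [integral_const_mul]
          exact mul_le_mul_of_nonneg_left hi2 (by positivity)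
  have e5 : sin θ * (c1 * c2) ≤ (2 * π * v)⁻¹ := by
    have h1 : sin θ * √(2 * π * v) ≤ √(2 * π * v2) := by
      apply Real.le_sqrt_of_sq_le
      rw [mul_pow, Real.sq_sqrt (by positivity), hv2r]
      have : 0 ≤ 2 * π * v := by positivity
      nlinarith
    have h2 : 0 < √(2 * π * v) := by positivity
    have h3 : 0 < √(2 * π * v2) := by
      rw [hv2r]; positivity
    have h4 : (2 * π * v)⁻¹ = (√(2 * π * v))⁻¹ * (√(2 * π * v))⁻¹ := by
      rw [← mul_inv, Real.mul_self_sqrt (by positivity)]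
    rw [h4, hc1, hc2, hv1r]
    rw [show sin θ * ((√(2 * π * v))⁻¹ * (√(2 * π * v2))⁻¹) =
      (√(2 * π * v))⁻¹ * (sin θ * (√(2 * π * v2))⁻¹) by ring]
    refine mul_le_mul_of_nonneg_left ?_ (by positivity)
    rw [← div_eq_mul_inv, div_le_iff₀ h3, ← div_eq_inv_mul, le_div_iff₀ h2]
    exact h1
  calc _ ≤ sin θ * (c1 * c2 * E * T * T) := mul_le_mul_of_nonneg_left e4 hs0
    _ = (sin θ * (c1 * c2)) * (E * T ^ 2) := by ring
    _ ≤ (2 * π * v)⁻¹ * (E * T ^ 2) := mul_le_mul_of_nonneg_right e5 (by positivity)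
    _ = _ := by ring

end

section

open MeasureTheory ProbabilityTheory Filter Real Finset

lemma aux_gumbel_deriv (β m s : ℝ) :
    HasDerivAt (fun s => (rexp (-(β * (s - m))) + 2) * rexp (-rexp (-(β * (s - m)))))
      (β * rexp (-(β * (s - m))) * rexp (-rexp (-(β * (s - m)))) * (1 + rexp (-(β * (s - m))))) s := by
  have h0 : HasDerivAt (fun s => -(β * (s - m))) (-(β * 1)) s :=
    (((hasDerivAt_id s).sub_const m).const_mul β).fun_neg
  have h1 := h0.exp
  have h2 := (h1.add_const 2).fun_mul (h1.fun_neg.exp)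
  exact h2.congr_deriv (by ring)

lemma aux_gumbel_int (β m : ℝ) (hβ : 0 < β) :
    Integrable (fun s => β * rexp (-(β * (s - m))) * rexp (-rexp (-(β * (s - m)))) * (1 + rexp (-(β * (s - m))))) ∧
    ∫ s, β * rexp (-(β * (s - m))) * rexp (-rexp (-(β * (s - m)))) * (1 + rexp (-(β * (s - m)))) = 2 := by
  set G : ℝ → ℝ := fun s => (rexp (-(β * (s - m))) + 2) * rexp (-rexp (-(β * (s - m)))) with hG
  have t1 : Tendsto (fun s => β * (s - m)) atTop atTop :=
    (tendsto_atTop_add_const_right _ (-m) tendsto_id).const_mul_atTop hβ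
  have t2 : Tendsto (fun s => β * (s - m)) atBot atBot :=
    (tendsto_atBot_add_const_right _ (-m) tendsto_id).const_mul_atBot hβ
  have t3 : Tendsto (fun s => rexp (-(β * (s - m)))) atTop (nhds 0) :=
    tendsto_exp_neg_atTop_nhds_zero.comp t1
  have t4 : Tendsto (fun s => rexp (-(β * (s - m)))) atBot atTop :=
    tendsto_exp_atTop.comp (tendsto_neg_atBot_atTop.comp t2)
  have ltop : Tendsto G atTop (nhds 2) := by
    have : Tendsto G atTop (nhds ((0 + 2) * rexp (-0))) :=
      (t3.add_const 2).mul ((continuous_exp.tendsto _).comp t3.neg)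
    simpa using this
  have lbot : Tendsto G atBot (nhds 0) := by
    have a : Tendsto (fun w : ℝ => (w + 2) * rexp (-w)) atTop (nhds 0) := by
      have b1 := tendsto_pow_mul_exp_neg_atTop_nhds_zero 1
      have b2 := tendsto_exp_neg_atTop_nhds_zero.const_mul 2
      have := b1.add b2
      simp only [pow_one, mul_zero, add_zero] at this
      refine this.congr fun w => by ring
    exact a.comp t4
  have hpos : ∀ s, 0 ≤ β * rexp (-(β * (s - m))) * rexp (-rexp (-(β * (s - m)))) * (1 + rexp (-(β * (s - m)))) :=
    fun s => by positivity
  have hi : Integrable (fun s => β * rexp (-(β * (s - m))) * rexp (-rexp (-(β * (s - m)))) * (1 + rexp (-(β * (s - m))))) := by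
    rw [← integrableOn_univ, ← Set.Iic_union_Ioi (a := (0:ℝ)), integrableOn_union]
    constructor
    · refine integrableOn_Iic_of_intervalIntegral_norm_bounded (G 0) 0 (a := id) (l := atBot) (fun i => ?_) tendsto_id ?_
      · exact (Continuous.integrableOn_Icc (by fun_prop)).mono_set Set.Ioc_subset_Icc_self
      · filter_upwards with i
        have : (fun x => ‖β * rexp (-(β * (x - m))) * rexp (-rexp (-(β * (x - m)))) * (1 + rexp (-(β * (x - m))))‖) = fun x => β * rexp (-(β * (x - m))) * rexp (-rexp (-(β * (x - m)))) * (1 + rexp (-(β * (x - m)))) := by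
          ext x; exact Real.norm_of_nonneg (hpos x)
        rw [this, intervalIntegral.integral_eq_sub_of_hasDerivAt (fun x _ => aux_gumbel_deriv β m x)
          (Continuous.intervalIntegrable (by fun_prop) _ _)]
        have : 0 ≤ (rexp (-(β * (id i - m))) + 2) * rexp (-rexp (-(β * (id i - m)))) := by positivity
        simp only [hG]
        linarith
    · exact integrableOn_Ioi_deriv_of_nonneg' (fun x _ => aux_gumbel_deriv β m x) (fun x _ => hpos x) ltop
  refine ⟨hi, ?_⟩
  rw [integral_of_hasDerivAt_of_tendsto (fun x => aux_gumbel_deriv β m x) hi lbot ltop]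
  simp

lemma aux_gumbel (β m l : ℝ) (hβ : 0 < β) (hl0 : 0 ≤ l) (hl : l ≤ β) :
    Integrable (fun s => β * rexp (-(β * (s - m))) * rexp (-rexp (-(β * (s - m)))) * rexp (-(l * (s - m)))) ∧
    ∫ s, β * rexp (-(β * (s - m))) * rexp (-rexp (-(β * (s - m)))) * rexp (-(l * (s - m))) ≤ 2 := by
  obtain ⟨h1, h2⟩ := aux_gumbel_int β m hβ
  have hle : ∀ s, β * rexp (-(β * (s - m))) * rexp (-rexp (-(β * (s - m)))) * rexp (-(l * (s - m))) ≤
      β * rexp (-(β * (s - m))) * rexp (-rexp (-(β * (s - m)))) * (1 + rexp (-(β * (s - m)))) := by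
    intro s
    refine mul_le_mul_of_nonneg_left ?_ (by positivity)
    rcases le_total m s with h | h
    · have : rexp (-(l * (s - m))) ≤ 1 := by
        rw [exp_le_one_iff]; nlinarith
      linarith [exp_pos (-(β * (s - m)))]
    · have : rexp (-(l * (s - m))) ≤ rexp (-(β * (s - m))) := by
        rw [exp_le_exp]; nlinarith
      linarith
  have hi : Integrable (fun s => β * rexp (-(β * (s - m))) * rexp (-rexp (-(β * (s - m)))) * rexp (-(l * (s - m)))) := by
    refine h1.mono' (Continuous.aestronglyMeasurable (by fun_prop)) (Eventually.of_forall fun s => ?_)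
    rw [Real.norm_of_nonneg (by positivity)]
    exact hle s
  exact ⟨hi, h2 ▸ integral_mono hi h1 hle⟩

lemma aux_gumbel_bdd (β m s : ℝ) (hβ : 0 < β) :
    β * rexp (-(β * (s - m))) * rexp (-rexp (-(β * (s - m)))) ≤ β := by
  set w := rexp (-(β * (s - m)))
  have hw : 0 < w := exp_pos _
  have h1 : w ≤ rexp w := by linarith [add_one_le_exp w]
  have : w * rexp (-w) ≤ 1 := by
    rw [exp_neg, ← div_eq_mul_inv, div_le_one (exp_pos _)]; exact h1
  nlinarith

end

section

open MeasureTheory ProbabilityTheory Filter Real Finset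

lemma aux_S_eq (n : ℕ) (x y : V n) :
    (n : ℝ) - 2 * (hammingDist x y : ℝ) = ∑ i, (if x i = y i then (1 : ℝ) else -1) := by
  have h : (hammingDist x y : ℝ) = ∑ i, (if x i = y i then (0 : ℝ) else 1) := by
    rw [hammingDist, Finset.card_filter]
    push_cast
    refine Finset.sum_congr rfl fun i _ => ?_
    by_cases h : x i = y i <;> simp [h]
  have h2 : (n : ℝ) = ∑ i : Fin n, (1 : ℝ) := by simp
  rw [h, h2, Finset.mul_sum, ← Finset.sum_sub_distrib]
  refine Finset.sum_congr rfl fun i _ => ?_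
  by_cases h : x i = y i <;> simp [h]
  norm_num

lemma aux_expS (n : ℕ) (y : V n) (l : ℝ) :
    ∑ x : V n, rexp (l * ((n : ℝ) - 2 * (hammingDist x y : ℝ))) ≤ 2 ^ n * rexp (n * l ^ 2 / 2) := by
  have h : ∑ x : V n, rexp (l * ((n : ℝ) - 2 * (hammingDist x y : ℝ))) = (2 * cosh l) ^ n := by
    have h1 : ∀ x : V n, rexp (l * ((n : ℝ) - 2 * (hammingDist x y : ℝ))) =
        ∏ i, rexp (l * (if x i = y i then (1 : ℝ) else -1)) := by
      intro x
      rw [aux_S_eq, ← exp_sum, Finset.mul_sum]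
    have h2 := Finset.prod_univ_sum (fun _ : Fin n => (Finset.univ : Finset Bool))
      (fun i b => rexp (l * (if b = y i then (1 : ℝ) else -1)))
    rw [Fintype.piFinset_univ] at h2
    rw [Finset.sum_congr rfl fun x _ => h1 x, ← h2]
    have : ∀ i, ∑ b : Bool, rexp (l * (if b = y i then (1 : ℝ) else -1)) = 2 * cosh l := by
      intro i
      rw [Real.cosh_eq]
      cases y i <;> simp <;> ring
    rw [Finset.prod_congr rfl fun i _ => this i]; simp
  rw [h, mul_pow]
  refine mul_le_mul_of_nonneg_left ?_ (by positivity)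
  calc cosh l ^ n ≤ rexp (l ^ 2 / 2) ^ n := by
        gcongr
        exact cosh_le_exp_half_sq l
    _ = _ := by rw [← exp_nat_mul]; ring_nf

lemma aux_gauss_quarter : Integrable (fun g : ℝ => rexp (g ^ 2 / 4)) (gaussianReal 0 1) ∧
    ∫ g, rexp (g ^ 2 / 4) ∂(gaussianReal 0 1) ≤ 2 := by
  have e : ∀ g : ℝ, gaussianPDFReal 0 1 g * rexp (g ^ 2 / 4) =
      (√(2 * π))⁻¹ * rexp (-(1 / 4) * g ^ 2) := by
    intro g
    simp only [gaussianPDFReal, NNReal.coe_one, mul_one, sub_zero]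
    rw [mul_assoc, ← exp_add]; ring_nf
  constructor
  · rw [gaussianReal_of_var_ne_zero _ one_ne_zero,
      integrable_withDensity_iff_integrable_smul' (measurable_gaussianPDF _ _)
        (Eventually.of_forall fun x => by simp [gaussianPDF])]
    have : (fun g : ℝ => (gaussianPDF 0 1 g).toReal • rexp (g ^ 2 / 4)) =
        fun g => (√(2 * π))⁻¹ * rexp (-(1 / 4) * g ^ 2) := by
      ext g
      rw [toReal_gaussianPDF, smul_eq_mul, e]
    rw [this]
    exact (integrable_exp_neg_mul_sq (by norm_num)).const_mul _
  · rw [integral_gaussianReal_eq_integral_smul one_ne_zero]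
    simp only [smul_eq_mul, e]
    rw [integral_const_mul, integral_gaussian]
    rw [← div_eq_inv_mul, div_le_iff₀ (by positivity)]
    apply Real.sqrt_le_iff.2
    refine ⟨by positivity, ?_⟩
    rw [mul_pow, Real.sq_sqrt (by positivity)]
    have := pi_pos
    rw [div_le_iff₀ (by norm_num)]; linarith

lemma aux_expS2 (n : ℕ) (hn : 1 ≤ n) (y : V n) :
    ∑ x : V n, rexp (((n : ℝ) - 2 * (hammingDist x y : ℝ)) ^ 2 / (4 * n)) ≤ 2 ^ n * 2 := by
  have hn0 : (0 : ℝ) < n := by exact_mod_cast hn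
  have hs : √(2 * (n : ℝ)) ^ 2 = 2 * n := Real.sq_sqrt (by positivity)
  have hs0 : 0 < √(2 * (n : ℝ)) := by positivity
  have h1 : ∀ S : ℝ, rexp (S ^ 2 / (4 * n)) = ∫ g, rexp (g / √(2 * n) * S) ∂(gaussianReal 0 1) := by
    intro S
    have := congrFun (mgf_id_gaussianReal (μ := 0) (v := 1)) (S / √(2 * n))
    simp only [mgf, id] at this
    have e : (fun g : ℝ => rexp (g / √(2 * n) * S)) = fun g => rexp (S / √(2 * n) * g) := by
      ext g; ring_nf
    rw [e, this]
    congr 1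
    rw [div_pow, hs]
    push_cast
    field_simp
    ring
  have hIntg : ∀ S : ℝ, Integrable (fun g => rexp (g / √(2 * n) * S)) (gaussianReal 0 1) := by
    intro S
    have := integrable_exp_mul_gaussianReal (μ := 0) (v := 1) (S / √(2 * n))
    refine this.congr (Eventually.of_forall fun g => ?_)
    simp only
    ring_nf
  rw [Finset.sum_congr rfl fun x _ => h1 _, ← integral_finsetSum _ fun x _ => hIntg _]
  calc _ ≤ ∫ g, 2 ^ n * rexp (g ^ 2 / 4) ∂(gaussianReal 0 1) := by
        refine integral_mono (integrable_finsetSum _ fun x _ => hIntg _)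
          (aux_gauss_quarter.1.const_mul _) fun g => ?_
        refine (aux_expS n y _).trans (le_of_eq ?_)
        congr 2
        rw [div_pow, hs]
        field_simp
        ring
    _ ≤ _ := by
        rw [integral_const_mul]
        exact mul_le_mul_of_nonneg_left aux_gauss_quarter.2 (by positivity)

lemma aux_sumbound (p n : ℕ) (hn : 1 ≤ n) (G : ℝ) (hG : G ≤ 1 / 8) :
    ∑ y : V n, ∑ x : V n, |overlap n x y| ^ p * rexp (G * n * overlap n x y ^ 2) ≤
      4 ^ n * (2 * (1 + 8 ^ p * p.factorial)) * (n : ℝ) ^ (-((p : ℝ) / 2)) := by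
  have hn0 : (0 : ℝ) < n := by exact_mod_cast hn
  have key : ∀ x y : V n, |overlap n x y| ^ p * rexp (G * n * overlap n x y ^ 2) ≤
      ((1 + 8 ^ p * p.factorial) * (n : ℝ) ^ (-((p : ℝ) / 2))) *
        rexp (((n : ℝ) - 2 * (hammingDist x y : ℝ)) ^ 2 / (4 * n)) := by
    intro x y
    set R := overlap n x y with hR
    have hS : ((n : ℝ) - 2 * (hammingDist x y : ℝ)) = n * R := by
      rw [hR, overlap]; field_simp
    rw [hS]
    set w := √(n : ℝ) * |R| with hw
    have hw0 : 0 ≤ w := by positivity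
    have hw2 : w ^ 2 = n * R ^ 2 := by rw [hw, mul_pow, Real.sq_sqrt hn0.le, sq_abs]
    have h1 : |R| ^ p = (n : ℝ) ^ (-((p : ℝ) / 2)) * w ^ p := by
      rw [hw, mul_pow, ← mul_assoc, Real.rpow_neg hn0.le]
      have : (n : ℝ) ^ ((p : ℝ) / 2) = √(n : ℝ) ^ p := by
        rw [Real.sqrt_eq_rpow, ← Real.rpow_natCast, ← Real.rpow_mul hn0.le]; ring_nf
      rw [this, inv_mul_cancel₀ (by positivity), one_mul]
    have h2 : w ^ p ≤ (1 + 8 ^ p * p.factorial) * rexp (w ^ 2 / 8) := by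
      have a1 : w ^ p ≤ 1 + (w ^ p) ^ 2 := by nlinarith [sq_nonneg (w ^ p - 1)]
      have a2 := Real.pow_div_factorial_le_exp (w ^ 2 / 8) (by positivity) p
      rw [div_le_iff₀ (by positivity), div_pow, div_le_iff₀ (by positivity)] at a2
      have a3 : 1 ≤ rexp (w ^ 2 / 8) := by rw [one_le_exp_iff]; positivity
      have a4 : (w ^ p) ^ 2 = (w ^ 2) ^ p := by ring
      nlinarith
    have h3 : rexp (G * n * R ^ 2) ≤ rexp (w ^ 2 / 8) := by
      rw [exp_le_exp, hw2]
      have : 0 ≤ n * R ^ 2 := by positivity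
      nlinarith
    have h4 : rexp ((n * R) ^ 2 / (4 * n)) = rexp (w ^ 2 / 8) * rexp (w ^ 2 / 8) := by
      rw [← exp_add, hw2]; congr 1; field_simp; ring
    rw [h1, h4]
    calc (n : ℝ) ^ (-((p : ℝ) / 2)) * w ^ p * rexp (G * n * R ^ 2) ≤
        (n : ℝ) ^ (-((p : ℝ) / 2)) * ((1 + 8 ^ p * p.factorial) * rexp (w ^ 2 / 8)) * rexp (w ^ 2 / 8) := by
          gcongr
      _ = _ := by ring
  calc _ ≤ ∑ y : V n, ∑ x : V n, ((1 + 8 ^ p * p.factorial) * (n : ℝ) ^ (-((p : ℝ) / 2))) *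
        rexp (((n : ℝ) - 2 * (hammingDist x y : ℝ)) ^ 2 / (4 * n)) :=
        Finset.sum_le_sum fun y _ => Finset.sum_le_sum fun x _ => key x y
    _ ≤ ∑ y : V n, ((1 + 8 ^ p * p.factorial) * (n : ℝ) ^ (-((p : ℝ) / 2))) * (2 ^ n * 2) := by
        refine Finset.sum_le_sum fun y _ => ?_
        rw [← Finset.mul_sum]
        exact mul_le_mul_of_nonneg_left (aux_expS2 n hn y) (by positivity)
    _ = _ := by
        simp only [Finset.sum_const, Finset.card_univ, V, Fintype.card_pi, Fintype.card_bool, Finset.prod_const, Fintype.card_fin, nsmul_eq_mul]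
        push_cast
        rw [show (4 : ℝ) = 2 * 2 by norm_num, mul_pow]
        ring

lemma aux_overlap_le (n : ℕ) (hn : 1 ≤ n) (x y : V n) : |overlap n x y| ≤ 1 := by
  have hn0 : (0 : ℝ) < n := by exact_mod_cast hn
  have h1 : (hammingDist x y : ℝ) ≤ n := by
    have := hammingDist_le_card_fintype (x := x) (y := y)
    simp only [Fintype.card_fin] at this
    exact_mod_cast this
  have h2 : 2 * (hammingDist x y : ℝ) / n ≤ 2 := by rw [div_le_iff₀ hn0]; linarith
  have h3 : 0 ≤ 2 * (hammingDist x y : ℝ) / n := by positivity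
  rw [overlap, abs_le]
  constructor <;> linarith

end

section

open MeasureTheory ProbabilityTheory Filter Real Finset

noncomputable def auxq (n m : ℕ) (xs : Fin (m + 1) → V n) : ℝ :=
  ((2 : ℝ) ^ n)⁻¹ *
    ∏ k : Fin m, (if hammingDist (xs k.castSucc) (xs k.succ) = 1 then (n : ℝ)⁻¹ else 0)

lemma auxq_nonneg (n m : ℕ) (xs : Fin (m + 1) → V n) : 0 ≤ auxq n m xs := by
  unfold auxq
  refine mul_nonneg (by positivity) (Finset.prod_nonneg fun k _ => ?_)
  split_ifs <;> positivity

lemma aux_nbr (n : ℕ) (hn : 1 ≤ n) (x : V n) :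
    ∑ z : V n, (if hammingDist x z = 1 then (n : ℝ)⁻¹ else 0) = 1 := by
  have h : (Finset.univ.filter fun z : V n => hammingDist x z = 1) =
      Finset.univ.image (fun i : Fin n => Function.update x i (!x i)) := by
    ext z
    simp only [Finset.mem_filter, Finset.mem_univ, true_and, Finset.mem_image, hammingDist,
      Finset.card_eq_one]
    constructor
    · rintro ⟨i, hi⟩
      refine ⟨i, ?_⟩
      ext j
      have hj : x j ≠ z j ↔ j = i := by
        have := Finset.ext_iff.1 hi j
        simpa using this
      by_cases h : j = i
      · have := hj.2 h
        subst h
        simp only [Function.update_self]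
        cases hx : x j <;> cases hz : z j <;> simp_all
      · rw [Function.update_of_ne h]
        by_contra h'
        exact h (hj.1 h')
    · rintro ⟨i, rfl⟩
      refine ⟨i, ?_⟩
      ext j
      by_cases h : j = i
      · subst h; simp
      · simp [h]
  rw [← Finset.sum_filter, h, Finset.sum_const, Finset.card_image_of_injective]
  · have hn0 : (n : ℝ) ≠ 0 := by positivity
    simp [hn0]
  · intro i j hij
    by_contra hne
    have := congrFun hij i
    simp only [Function.update_self, Function.update_of_ne hne] at this
    cases hx : x i <;> simp_all

lemma aux_sum_snoc {α : Type*} [Fintype α] (m : ℕ) (f : (Fin (m + 1) → α) → ℝ) :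
    ∑ xs, f xs = ∑ xs' : Fin m → α, ∑ z : α, f (Fin.snoc xs' z) := by
  rw [← (Fin.snocEquiv (fun _ : Fin (m + 1) => α)).sum_comp, Fintype.sum_prod_type, Finset.sum_comm]
  rfl

lemma auxq_snoc (n m : ℕ) (xs : Fin (m + 1) → V n) (z : V n) :
    auxq n (m + 1) (Fin.snoc xs z) =
      auxq n m xs * (if hammingDist (xs (Fin.last m)) z = 1 then (n : ℝ)⁻¹ else 0) := by
  unfold auxq
  rw [Fin.prod_univ_castSucc]
  simp only [Fin.snoc_castSucc, ← Fin.castSucc_succ, Fin.succ_last, Fin.snoc_last]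
  rw [mul_assoc]

lemma auxq_marg (n : ℕ) (hn : 1 ≤ n) (m : ℕ) : ∀ (k : Fin (m + 1)) (x : V n),
    ∑ xs, (if xs k = x then auxq n m xs else 0) = ((2 : ℝ) ^ n)⁻¹ := by
  induction m with
  | zero =>
    intro k x
    rw [aux_sum_snoc]
    have hk : k = Fin.last 0 := Fin.ext (by have := k.2; simp only [Fin.val_last]; omega)
    subst hk
    simp only [Fin.snoc_last]
    simp [auxq]
  | succ m ih =>
    intro k x
    rw [aux_sum_snoc]
    simp only [auxq_snoc]
    refine Fin.lastCases ?_ (fun k => ?_) k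
    · simp only [Fin.snoc_last, Finset.sum_ite_eq', Finset.mem_univ, if_true]
      have : ∀ xs : Fin (m + 1) → V n, auxq n m xs *
          (if hammingDist (xs (Fin.last m)) x = 1 then (n : ℝ)⁻¹ else 0) =
          ∑ w : V n, (if hammingDist x w = 1 then (n : ℝ)⁻¹ else 0) *
            (if xs (Fin.last m) = w then auxq n m xs else 0) := by
        intro xs
        simp only [mul_ite, mul_zero]
        rw [Finset.sum_ite_eq]
        simp only [Finset.mem_univ, if_true]
        rw [hammingDist_comm]
        split_ifs <;> ring
      rw [Finset.sum_congr rfl fun xs _ => this xs, Finset.sum_comm]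
      simp only [← Finset.mul_sum, ih]
      rw [← Finset.sum_mul, aux_nbr n hn, one_mul]
    · simp only [Fin.snoc_castSucc]
      rw [← ih k x]
      refine Finset.sum_congr rfl fun xs _ => ?_
      split_ifs
      · rw [← Finset.mul_sum, aux_nbr n hn, mul_one]
      · simp

lemma auxq_sum (n : ℕ) (hn : 1 ≤ n) (m : ℕ) : ∑ xs, auxq n m xs = 1 := by
  have h : ∑ x : V n, ∑ xs, (if xs (0 : Fin (m + 1)) = x then auxq n m xs else 0) = 1 := by
    simp only [auxq_marg n hn m]
    simp [V]
  rw [Finset.sum_comm] at h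
  simpa using h

/-- mixed event -/
def auxE {Ω' : Type*} (J : (n : ℕ) → ℕ → Ω' → V n) (e : ℕ → ℕ → Ω' → ℝ) (n m : ℕ) (xs : Fin (m + 1) → V n) (S : Finset (Fin (m + 1))) (y : Fin (m + 1) → ℝ) : Set Ω' :=
  {ω | (∀ k : Fin (m + 1), J n k ω = xs k) ∧ ∀ k : Fin (m + 1),
    if k ∈ S then 0 < e n k ω ∧ e n k ω ≤ y k else y k < e n k ω}

lemma auxE_meas {Ω' : Type*} [MeasurableSpace Ω']
    (J : (n : ℕ) → ℕ → Ω' → V n) (e : ℕ → ℕ → Ω' → ℝ)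
    (hJmeas : ∀ n i, Measurable (J n i)) (hemeas : ∀ n i, Measurable (e n i))
    (n m : ℕ) (xs : Fin (m + 1) → V n) (S : Finset (Fin (m + 1))) (y : Fin (m + 1) → ℝ) :
    MeasurableSet (auxE J e n m xs S y) := by
  unfold auxE
  refine MeasurableSet.inter (s₁ := {ω | (∀ k : Fin (m + 1), J n k ω = xs k)}) ?_ ?_
  · rw [Set.ofPred_forall]
    exact MeasurableSet.iInter fun k => hJmeas n k (measurableSet_singleton (xs k))
  · change MeasurableSet {ω | _}
    rw [Set.ofPred_forall]
    refine MeasurableSet.iInter fun k => ?_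
    split_ifs
    · exact (measurableSet_lt measurable_const (hemeas n k)).inter
        (measurableSet_le (hemeas n k) measurable_const)
    · exact measurableSet_lt measurable_const (hemeas n k)

lemma auxE_law {Ω' : Type*} [MeasurableSpace Ω'] (Pw : Measure Ω') [IsProbabilityMeasure Pw]
    (J : (n : ℕ) → ℕ → Ω' → V n) (e : ℕ → ℕ → Ω' → ℝ)
    (hJmeas : ∀ n i, Measurable (J n i)) (hemeas : ∀ n i, Measurable (e n i))
    (hlaw : WalkExpLaw Pw J e)
    (n m : ℕ) (xs : Fin (m + 1) → V n) (S : Finset (Fin (m + 1))) :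
    ∀ y : Fin (m + 1) → ℝ, (∀ k, 0 ≤ y k) → Pw.real (auxE J e n m xs S y) =
      auxq n m xs * ∏ k, (if k ∈ S then 1 - rexp (-y k) else rexp (-y k)) := by
  induction S using Finset.induction_on with
  | empty =>
    intro y hy
    have : _ = ENNReal.ofReal (auxq n m xs) * ENNReal.ofReal (rexp (-∑ k, y k)) := hlaw n m xs y hy
    have h2 : auxE J e n m xs ∅ y = {ω' | (∀ k : Fin (m + 1), J n k ω' = xs k) ∧ (∀ k : Fin (m + 1), y k < e n k ω')} := by
      simp [auxE]
    rw [measureReal_def, h2, this, ENNReal.toReal_mul, ENNReal.toReal_ofReal (auxq_nonneg n m xs),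
      ENNReal.toReal_ofReal (exp_pos _).le]
    simp only [Finset.notMem_empty, if_false]
    rw [← exp_sum, Finset.sum_neg_distrib]
  | insert a S ha ih =>
    intro y hy
    have hsub : auxE J e n m xs S y ⊆ auxE J e n m xs S (Function.update y a 0) := by
      rintro ω ⟨h1, h2⟩
      refine ⟨h1, fun k => ?_⟩
      have := h2 k
      by_cases hk : k = a
      · subst hk
        simp only [ha, if_false, Function.update_self] at this ⊢
        exact (hy k).trans_lt this
      · rw [Function.update_of_ne hk]; exact this
    have heq : auxE J e n m xs (insert a S) y =
        auxE J e n m xs S (Function.update y a 0) \ auxE J e n m xs S y := by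
      ext ω
      constructor
      · rintro ⟨h1, h2⟩
        refine ⟨⟨h1, fun k => ?_⟩, fun h3 => ?_⟩
        · have := h2 k
          by_cases hk : k = a
          · subst hk
            simp only [ha, if_false, Function.update_self, Finset.mem_insert_self, if_true] at this ⊢
            exact this.1
          · rw [Function.update_of_ne hk]
            simpa [hk] using this
        · have a1 := h2 a
          have a2 := h3.2 a
          simp only [ha, if_false, Finset.mem_insert_self, if_true] at a1 a2
          linarith [a1.2]
      · rintro ⟨⟨h1, h2⟩, h3⟩
        refine ⟨h1, fun k => ?_⟩
        have b := h2 k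
        by_cases hk : k = a
        · subst hk
          simp only [ha, if_false, Function.update_self, Finset.mem_insert_self, if_true] at b ⊢
          refine ⟨b, ?_⟩
          by_contra hlt
          push Not at hlt
          refine h3 ⟨h1, fun l => ?_⟩
          by_cases hl : l = k
          · subst hl; simpa [ha] using hlt
          · have := h2 l
            rwa [Function.update_of_ne hl] at this
        · rw [Function.update_of_ne hk] at b
          simpa [hk] using b
    rw [heq, measureReal_sdiff hsub (auxE_meas J e hJmeas hemeas n m xs S y), ih y hy, ih _ (fun k => ?_),
      ← Finset.mul_prod_erase _ _ (Finset.mem_univ a), ← Finset.mul_prod_erase _ _ (Finset.mem_univ a),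
      ← Finset.mul_prod_erase _ _ (Finset.mem_univ a)]
    · have e1 : ∏ k ∈ Finset.univ.erase a, (if k ∈ S then 1 - rexp (-Function.update y a 0 k) else rexp (-Function.update y a 0 k)) = ∏ k ∈ Finset.univ.erase a, (if k ∈ S then 1 - rexp (-y k) else rexp (-y k)) := by
        refine Finset.prod_congr rfl fun k hk => ?_
        rw [Function.update_of_ne (Finset.ne_of_mem_erase hk)]
      have e2 : ∏ k ∈ Finset.univ.erase a, (if k ∈ insert a S then 1 - rexp (-y k) else rexp (-y k)) = ∏ k ∈ Finset.univ.erase a, (if k ∈ S then 1 - rexp (-y k) else rexp (-y k)) := by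
        refine Finset.prod_congr rfl fun k hk => ?_
        simp [Finset.ne_of_mem_erase hk]
      rw [e1, e2]
      simp [ha]
      ring
    · by_cases hk : k = a
      · subst hk; simp
      · rw [Function.update_of_ne hk]; exact hy k

noncomputable def auxF (β m s : ℝ) : ℝ := 1 - rexp (-rexp (-(β * (s - m))))

noncomputable def auxPsi (n T : ℕ) (β m : ℝ) (h : V n → ℝ) : ℝ :=
  ∑ xs : Fin (T + 1) → V n, auxq n T xs * ∏ k : Fin T, auxF β m (h (xs k.succ))

lemma aux_path_sum {Ω' : Type*} [MeasurableSpace Ω'] (Pw : Measure Ω') [IsProbabilityMeasure Pw]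
    (J : (n : ℕ) → ℕ → Ω' → V n) (hJmeas : ∀ n i, Measurable (J n i)) (n m : ℕ) (A : Set Ω')
    (hA : MeasurableSet A) :
    Pw.real A = ∑ xs : Fin (m + 1) → V n, Pw.real {ω | (∀ k : Fin (m + 1), J n k ω = xs k) ∧ ω ∈ A} := by
  have h : A = ⋃ xs ∈ (Finset.univ : Finset (Fin (m + 1) → V n)),
      {ω | (∀ k : Fin (m + 1), J n k ω = xs k) ∧ ω ∈ A} := by
    ext ω
    simp only [Finset.mem_univ, Set.iUnion_true, Set.mem_iUnion, Set.mem_ofPred_eq]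
    exact ⟨fun h => ⟨fun k => J n k ω, fun k => rfl, h⟩, fun ⟨_, _, h⟩ => h⟩
  conv_lhs => rw [h]
  rw [measureReal_biUnion_finset]
  · intro xs _ ys _ hne
    refine Set.disjoint_left.2 ?_
    rintro ω ⟨h1, _⟩ ⟨h2, _⟩
    exact hne (funext fun k => (h1 k).symm.trans (h2 k))
  · intro xs _
    refine MeasurableSet.inter (s₁ := {ω | (∀ k : Fin (m + 1), J n k ω = xs k)}) ?_ hA
    rw [Set.ofPred_forall]
    exact MeasurableSet.iInter fun k => hJmeas n k (measurableSet_singleton (xs k))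

lemma aux_nuMax {Ω' : Type*} [MeasurableSpace Ω'] (Pw : Measure Ω') [IsProbabilityMeasure Pw]
    (J : (n : ℕ) → ℕ → Ω' → V n) (e : ℕ → ℕ → Ω' → ℝ)
    (hJmeas : ∀ n i, Measurable (J n i)) (hemeas : ∀ n i, Measurable (e n i))
    (hlaw : WalkExpLaw Pw J e) (c : ℝ) (β : ℕ → ℝ) (n : ℕ) (hn : 1 ≤ n) (t u : ℝ) (hu : 0 < u)
    (h : V n → ℝ) :
    nuMax Pw J e c β n t u h =
      (kseq c n t : ℝ) * (1 - auxPsi n (θseq n) (β n) (γseq c n * n + log u / γseq c n) h) := by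
  have hn0 : (0 : ℝ) < n := by exact_mod_cast hn
  have hγ : 0 < γseq c n := Real.rpow_pos_of_pos hn0 _
  set m := γseq c n * n + log u / γseq c n with hm
  have hthr : cseq c β n * u ^ (β n / γseq c n) = rexp (β n * m) := by
    rw [cseq, Real.rpow_def_of_pos hu, ← exp_add, hm]
    congr 1
    field_simp
  unfold nuMax
  rw [hthr]
  congr 1
  set T := θseq n with hT
  set A : Set Ω' := {ω' | ∃ j ∈ Icc 1 T, rexp (β n * m) < rexp (β n * h (J n j ω')) * e n j ω'} with hA
  have hev : ∀ j ω, (rexp (β n * m) < rexp (β n * h (J n j ω)) * e n j ω) ↔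
      rexp (-(β n * (h (J n j ω) - m))) < e n j ω := by
    intro j ω
    rw [show -(β n * (h (J n j ω) - m)) = β n * m - β n * h (J n j ω) by ring, exp_sub,
      div_lt_iff₀ (exp_pos _), mul_comm (e n j ω)]
  have hAm : MeasurableSet A := by
    have : A = ⋃ j ∈ Icc 1 T, {ω' | rexp (β n * m) < rexp (β n * h (J n j ω')) * e n j ω'} := by
      ext ω; simp [hA]
    rw [this]
    refine Finset.measurableSet_biUnion _ fun j _ => ?_
    refine measurableSet_lt measurable_const (Measurable.mul ?_ (hemeas n j))
    exact (measurable_of_countable (fun x : V n => rexp (β n * h x))).comp (hJmeas n j)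
  set G : Set Ω' := {ω | ∀ k : Fin (T + 1), 0 < e n k ω} with hG
  have hGm : MeasurableSet G := by
    rw [hG, Set.ofPred_forall]
    exact MeasurableSet.iInter fun k => measurableSet_lt measurable_const (hemeas n k)
  have hG1 : Pw.real G = 1 := by
    rw [aux_path_sum Pw J hJmeas n T G hGm, ← auxq_sum n hn T]
    refine Finset.sum_congr rfl fun xs _ => ?_
    have := auxE_law Pw J e hJmeas hemeas hlaw n T xs ∅ (fun _ => 0) (fun _ => le_rfl)
    simp only [Finset.notMem_empty, if_false, neg_zero, exp_zero, Finset.prod_const_one, mul_one] at this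
    rw [← this]
    simp [auxE, hG]
  have hGae : ∀ᵐ ω ∂Pw, ω ∈ G := by
    rw [ae_iff]
    have : Pw.real Gᶜ = 0 := by rw [probReal_compl_eq_one_sub hGm, hG1, sub_self]
    exact (measureReal_eq_zero_iff).1 this
  have hc : Pw.real Aᶜ = auxPsi n T (β n) m h := by
    have : Pw.real Aᶜ = Pw.real (Aᶜ ∩ G) := by
      refine measureReal_congr ?_
      filter_upwards [hGae] with ω hω
      exact propext ⟨fun h => ⟨h, hω⟩, fun h => h.1⟩
    rw [this, aux_path_sum Pw J hJmeas n T _ (hAm.compl.inter hGm), auxPsi]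
    refine Finset.sum_congr rfl fun xs _ => ?_
    have hl := auxE_law Pw J e hJmeas hemeas hlaw n T xs (Finset.univ.erase 0)
      (fun k => if k = 0 then 0 else rexp (-(β n * (h (xs k) - m))))
      (fun k => by split_ifs <;> positivity)
    rw [Fin.prod_univ_succ] at hl
    simp only [Finset.mem_erase, Finset.mem_univ, ne_eq, not_true, false_and, if_false, if_true,
      neg_zero, exp_zero, one_mul, Fin.succ_ne_zero, not_false_iff, true_and] at hl
    simp only [auxF]
    refine Eq.trans ?_ hl
    congr 1
    ext ω
    constructor
    · rintro ⟨h1, h2, h3⟩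
      refine ⟨h1, fun k => ?_⟩
      by_cases hk : k = 0
      · subst hk
        simpa using h3 0
      · simp only [Finset.mem_erase, Finset.mem_univ, ne_eq, hk, not_false_iff, and_true, if_true, if_false]
        refine ⟨h3 k, ?_⟩
        by_contra hlt
        push Not at hlt
        refine h2 ⟨k, ?_, ?_⟩
        · rw [Finset.mem_Icc]
          have : (k : ℕ) ≠ 0 := fun h => hk (Fin.ext h)
          have := k.2
          omega
        · rw [hev, h1 k]; exact hlt
    · rintro ⟨h1, h2⟩
      refine ⟨h1, ?_, ?_⟩
      · rintro ⟨j, hj, hj2⟩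
        rw [Finset.mem_Icc] at hj
        have hjT : j < T + 1 := by omega
        have hk : (⟨j, hjT⟩ : Fin (T + 1)) ≠ 0 := by
          intro h; have := congrArg Fin.val h; simp at this; omega
        have a1 := h2 ⟨j, hjT⟩
        simp only [Finset.mem_erase, Finset.mem_univ, ne_eq, hk, not_false_iff, and_true, if_true, if_false] at a1
        rw [hev, h1 ⟨j, hjT⟩] at hj2
        exact absurd hj2 (not_lt.2 a1.2)
      · intro k
        have a1 := h2 k
        by_cases hk : k = 0
        · subst hk; simpa using a1
        · simp only [Finset.mem_erase, Finset.mem_univ, ne_eq, hk, not_false_iff, and_true, if_true, if_false] at a1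
          exact a1.1
  rw [← hc, probReal_compl_eq_one_sub hAm, measureReal_def]
  ring

end

section

open MeasureTheory ProbabilityTheory Filter Real Finset

lemma auxF_mem (β m s : ℝ) : 0 ≤ auxF β m s ∧ auxF β m s ≤ 1 := by
  unfold auxF
  have h1 : rexp (-rexp (-(β * (s - m)))) ≤ 1 := by
    rw [exp_le_one_iff]; linarith [exp_pos (-(β * (s - m)))]
  constructor
  · linarith
  · linarith [exp_pos (-rexp (-(β * (s - m))))]

lemma auxF_deriv (β m s : ℝ) : HasDerivAt (auxF β m)
    (-(β * rexp (-(β * (s - m))) * rexp (-rexp (-(β * (s - m)))))) s := by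
  have h0 : HasDerivAt (fun s => -(β * (s - m))) (-(β * 1)) s :=
    (((hasDerivAt_id s).sub_const m).const_mul β).fun_neg
  have h2 := (h0.exp.fun_neg.exp).const_sub 1
  exact h2.congr_deriv (by ring)

lemma auxPsi_contDiff (n T : ℕ) (β m : ℝ) : ContDiff ℝ 1 (auxPsi n T β m) := by
  unfold auxPsi auxF
  fun_prop

lemma auxPsi_abs (n : ℕ) (hn : 1 ≤ n) (T : ℕ) (β m : ℝ) (h : V n → ℝ) : |auxPsi n T β m h| ≤ 1 := by
  unfold auxPsi
  rw [abs_of_nonneg (Finset.sum_nonneg fun xs _ => mul_nonneg (auxq_nonneg n T xs)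
    (Finset.prod_nonneg fun k _ => (auxF_mem _ _ _).1)), ← auxq_sum n hn T]
  refine Finset.sum_le_sum fun xs _ => mul_le_of_le_one_right (auxq_nonneg n T xs) ?_
  exact Finset.prod_le_one (fun k _ => (auxF_mem _ _ _).1) (fun k _ => (auxF_mem _ _ _).2)

lemma auxPsi_fderiv (n : ℕ) (hn : 1 ≤ n) (T : ℕ) (β m : ℝ) (hβ : 0 < β) (h : V n → ℝ) (x : V n) :
    |fderiv ℝ (auxPsi n T β m) h (Pi.single x 1)| ≤
      (T * ((2 : ℝ) ^ n)⁻¹) * (β * rexp (-(β * (h x - m))) * rexp (-rexp (-(β * (h x - m))))) := by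
  set f : ℝ → ℝ := fun s => β * rexp (-(β * (s - m))) * rexp (-rexp (-(β * (s - m)))) with hf
  have hf0 : ∀ s, 0 ≤ f s := fun s => by simp only [hf]; positivity
  have hdiff : DifferentiableAt ℝ (auxPsi n T β m) h :=
    (auxPsi_contDiff n T β m).differentiable one_ne_zero h
  have hline : HasDerivAt (fun s : ℝ => h + s • (Pi.single x (1 : ℝ) : V n → ℝ)) (Pi.single x 1) 0 := by
    simpa using ((hasDerivAt_id (0 : ℝ)).smul_const (Pi.single x (1 : ℝ) : V n → ℝ)).const_add h
  have d1 : HasDerivAt (fun s : ℝ => auxPsi n T β m (h + s • (Pi.single x (1 : ℝ) : V n → ℝ)))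
      (fderiv ℝ (auxPsi n T β m) h (Pi.single x 1)) 0 := by
    have h0 : HasFDerivAt (auxPsi n T β m) (fderiv ℝ (auxPsi n T β m) h)
        (h + (0 : ℝ) • (Pi.single x (1 : ℝ) : V n → ℝ)) := by simpa using hdiff.hasFDerivAt
    exact h0.comp_hasDerivAt 0 hline
  have d2 : HasDerivAt (fun s : ℝ => auxPsi n T β m (h + s • (Pi.single x (1 : ℝ) : V n → ℝ)))
      (∑ xs : Fin (T + 1) → V n, auxq n T xs * ∑ k : Fin T,
        (∏ j ∈ Finset.univ.erase k, auxF β m (h (xs j.succ))) *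
          (if xs k.succ = x then -f (h x) else 0)) 0 := by
    unfold auxPsi
    refine HasDerivAt.fun_sum fun xs _ => HasDerivAt.const_mul _ ?_
    have hk : ∀ k : Fin T, HasDerivAt (fun s : ℝ => auxF β m ((h + s • (Pi.single x (1 : ℝ) : V n → ℝ)) (xs k.succ)))
        (if xs k.succ = x then -f (h x) else 0) 0 := by
      intro k
      have l1 : HasDerivAt (fun s : ℝ => (h + s • (Pi.single x (1 : ℝ) : V n → ℝ)) (xs k.succ))
          ((Pi.single x (1 : ℝ) : V n → ℝ) (xs k.succ)) 0 := hasDerivAt_pi.1 hline _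
      have l2 := auxF_deriv β m ((h + (0 : ℝ) • (Pi.single x (1 : ℝ) : V n → ℝ)) (xs k.succ))
      refine (l2.comp (0 : ℝ) l1).congr_deriv ?_
      by_cases hx : xs k.succ = x
      · simp [hx, hf]
      · simp [hx]
    have := HasDerivAt.fun_finsetProd (u := Finset.univ) (fun k _ => hk k)
    simpa using this
  rw [d1.unique d2]
  calc _ ≤ ∑ xs : Fin (T + 1) → V n, auxq n T xs * ∑ k : Fin T, (if xs k.succ = x then f (h x) else 0) := by
        refine (Finset.abs_sum_le_sum_abs _ _).trans (Finset.sum_le_sum fun xs _ => ?_)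
        rw [abs_mul, abs_of_nonneg (auxq_nonneg n T xs)]
        refine mul_le_mul_of_nonneg_left ?_ (auxq_nonneg n T xs)
        refine (Finset.abs_sum_le_sum_abs _ _).trans (Finset.sum_le_sum fun k _ => ?_)
        rw [abs_mul]
        have hp : |∏ j ∈ Finset.univ.erase k, auxF β m (h (xs j.succ))| ≤ 1 := by
          rw [abs_of_nonneg (Finset.prod_nonneg fun k _ => (auxF_mem _ _ _).1)]
          exact Finset.prod_le_one (fun k _ => (auxF_mem _ _ _).1) (fun k _ => (auxF_mem _ _ _).2)
        have hi : |if xs k.succ = x then -f (h x) else 0| = if xs k.succ = x then f (h x) else 0 := by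
          split_ifs
          · rw [abs_neg, abs_of_nonneg (hf0 _)]
          · simp
        rw [hi]
        refine mul_le_of_le_one_left ?_ hp
        split_ifs
        · exact hf0 _
        · exact le_rfl
    _ = ∑ k : Fin T, ∑ xs : Fin (T + 1) → V n, f (h x) * (if xs k.succ = x then auxq n T xs else 0) := by
        rw [Finset.sum_comm]
        refine Finset.sum_congr rfl fun xs _ => ?_
        rw [Finset.mul_sum]
        refine Finset.sum_congr rfl fun k _ => ?_
        split_ifs <;> ring
    _ = _ := by
        simp only [← Finset.mul_sum, auxq_marg n hn T]
        simp [hf]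
        ring
    _ ≤ _ := le_rfl

end

section

open MeasureTheory ProbabilityTheory Filter Real Finset

lemma aux_env {Ω : Type*} [MeasurableSpace Ω] (Pe : Measure Ω) [IsProbabilityMeasure Pe]
    {I : Type*} [Fintype I] [DecidableEq I] (X : I → Ω → ℝ) (D : I → I → ℝ)
    (hXm : ∀ x, Measurable (X x)) (hX : IsCenteredGaussianVector Pe X D)
    (v : ℝ) (hv : 0 ≤ v) (hD : ∀ x, D x x = v) (hDa : ∀ x y, |D x y| ≤ v)
    (hsymm : ∀ x y, D x y = D y x) :
    IsGaussian (Pe.map (fun ω x => X x ω)) ∧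
    (∀ x, ∫ h, h x ∂(Pe.map (fun ω x => X x ω)) = 0) ∧
    (∀ x y, ∫ h, h x * h y ∂(Pe.map (fun ω x => X x ω)) = D x y) := by
  have hm : Measurable (fun ω x => X x ω) := measurable_pi_lambda _ hXm
  have hlin : ∀ c : I → ℝ, Measurable (fun ω => ∑ i, c i * X i ω) := fun c =>
    Finset.measurable_fun_sum _ fun i _ => (hXm i).const_mul _
  -- integrals of linear forms
  have hmean : ∀ c : I → ℝ, ∫ ω, ∑ i, c i * X i ω ∂Pe = 0 := by
    intro c
    have := integral_map (μ := Pe) (hlin c).aemeasurable (f := fun z : ℝ => z)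
      (measurable_id.aestronglyMeasurable)
    rw [← this, hX c]
    exact integral_id_gaussianReal
  have hsq : ∀ c : I → ℝ, 0 ≤ (∑ i, ∑ j, c i * c j * D i j) →
      ∫ ω, (∑ i, c i * X i ω) ^ 2 ∂Pe = ∑ i, ∑ j, c i * c j * D i j := by
    intro c hc
    have := integral_map (μ := Pe) (hlin c).aemeasurable (f := fun z : ℝ => z ^ 2)
      (Measurable.aestronglyMeasurable (by fun_prop))
    rw [← this, hX c]
    have h2 := variance_fun_id_gaussianReal (μ := 0) (v := (∑ i, ∑ j, c i * c j * D i j).toNNReal)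
    rw [variance_of_integral_eq_zero (X := fun x : ℝ => x) measurable_id.aemeasurable integral_id_gaussianReal] at h2
    rw [h2, Real.coe_toNNReal _ hc]
  have hsingle : ∀ x ω, ∑ i, (Pi.single x (1 : ℝ) : I → ℝ) i * X i ω = X x ω := by
    intro x ω
    simp [Pi.single_apply]
  have hmem : ∀ x, MemLp (X x) 2 Pe := by
    intro x
    have h1 := hX (Pi.single x 1)
    simp only [hsingle] at h1
    have h2 : MemLp id 2 (Pe.map (X x)) := by
      rw [h1]; exact memLp_id_gaussianReal 2
    exact (memLp_map_measure_iff (by fun_prop) (hXm x).aemeasurable).1 h2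
  refine ⟨?_, ?_, ?_⟩
  · refine isGaussian_of_map_eq_gaussianReal fun L => ?_
    refine ⟨0, (∑ i, ∑ j, L (Pi.single i 1) * L (Pi.single j 1) * D i j).toNNReal, ?_⟩
    rw [Measure.map_map L.continuous.measurable hm, ← hX]
    congr 1
    ext ω
    have : (fun x => X x ω) = ∑ i, X i ω • (Pi.single i (1 : ℝ) : I → ℝ) := by
      ext j; simp [Pi.single_apply]
    simp only [Function.comp]
    rw [this, map_sum]
    refine Finset.sum_congr rfl fun i _ => ?_
    rw [map_smul, smul_eq_mul, mul_comm]
  · intro x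
    rw [integral_map hm.aemeasurable (Measurable.aestronglyMeasurable (by fun_prop))]
    have := hmean (Pi.single x 1)
    simpa only [hsingle] using this
  · intro x y
    rw [integral_map hm.aemeasurable (Measurable.aestronglyMeasurable (by fun_prop))]
    have s1 : ∀ x y, ∑ i, ∑ j, (Pi.single x (1 : ℝ) : I → ℝ) i * (Pi.single y (1 : ℝ) : I → ℝ) j * D i j = D x y := by
      intro x y
      simp [Pi.single_apply]
    have q1 : ∀ x, ∫ ω, X x ω ^ 2 ∂Pe = v := by
      intro x
      have := hsq (Pi.single x 1) (by rw [s1, hD]; exact hv)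
      rw [s1, hD] at this
      simpa only [hsingle] using this
    have s2 : ∑ i, ∑ j, ((Pi.single x (1 : ℝ) + Pi.single y (1 : ℝ) : I → ℝ) i) * ((Pi.single x (1 : ℝ) + Pi.single y (1 : ℝ) : I → ℝ) j) * D i j = 2 * v + 2 * D x y := by
      simp only [Pi.add_apply, add_mul, mul_add, Finset.sum_add_distrib, s1, hD, hsymm y x]
      ring
    have q2 : ∫ ω, (X x ω + X y ω) ^ 2 ∂Pe = 2 * v + 2 * D x y := by
      have := hsq (Pi.single x 1 + Pi.single y 1) (by rw [s2]; linarith [(abs_le.1 (hDa x y)).1])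
      rw [s2] at this
      simpa only [Pi.add_apply, add_mul, Finset.sum_add_distrib, hsingle] using this
    have ixy : Integrable (fun ω => X x ω * X y ω) Pe := (hmem x).integrable_mul (hmem y)
    have e : (fun ω => (X x ω + X y ω) ^ 2) = fun ω => (X x ω ^ 2 + X y ω ^ 2) + 2 * (X x ω * X y ω) := by
      ext ω; ring
    rw [e, integral_add ((hmem x).integrable_sq.fun_add (hmem y).integrable_sq) (ixy.const_mul 2),
      integral_const_mul] at q2
    have q3 : ∫ ω, (X x ω ^ 2 + X y ω ^ 2) ∂Pe = v + v := by
      rw [integral_add (hmem x).integrable_sq (hmem y).integrable_sq, q1, q1]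
    rw [q3] at q2
    linarith

end

open MeasureTheory ProbabilityTheory Filter Real Finset

lemma aux_varPsi (p n : ℕ) (hn : 1 ≤ n) (T : ℕ) (β m : ℝ) (hβ : 0 < β) (hm0 : 0 ≤ m)
    (hmβ : m ≤ β * n) (μ : Measure (V n → ℝ)) [IsGaussian μ]
    (hmean : ∀ x, ∫ h, h x ∂μ = 0)
    (hC : ∀ x y, ∫ h, h x * h y ∂μ = (n : ℝ) * overlap n x y ^ p) :
    ∫ h, auxPsi n T β m h ^ 2 ∂μ - (∫ h, auxPsi n T β m h ∂μ) ^ 2 ≤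
      (T : ℝ) ^ 2 * ((4 : ℝ) ^ n)⁻¹ * ∑ y : V n, ∑ x : V n,
        |overlap n x y| ^ p * rexp (-(m ^ 2 / (n * (1 + |overlap n x y| ^ p)))) := by
  have hn0 : (0 : ℝ) < n := by exact_mod_cast hn
  set q : ℝ := T * ((2 : ℝ) ^ n)⁻¹ with hq
  have hq0 : 0 ≤ q := by positivity
  set g : ℝ → ℝ := fun s => q * (β * rexp (-(β * (s - m))) * rexp (-rexp (-(β * (s - m))))) with hg
  have hgc : Continuous g := by rw [hg]; fun_prop
  have hg0 : ∀ s, 0 ≤ g s := fun s => by rw [hg]; positivity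
  have hgM : ∀ s, g s ≤ q * β := fun s =>
    mul_le_mul_of_nonneg_left (aux_gumbel_bdd β m s hβ) hq0
  have hself : ∀ x : V n, overlap n x x = 1 := fun x => by simp [overlap]
  have hCv : ∀ x : V n, (n : ℝ) * overlap n x x ^ p = n := fun x => by rw [hself]; simp
  have hr1 : ∀ x y : V n, |overlap n x y| ^ p ≤ 1 := fun x y =>
    pow_le_one₀ (abs_nonneg _) (aux_overlap_le n hn x y)
  have hab : ∀ x y : V n, |(n : ℝ) * overlap n x y ^ p| = n * |overlap n x y| ^ p := fun x y => by
    rw [abs_mul, abs_pow, abs_of_pos hn0]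
  refine (aux_var μ (fun x y => (n : ℝ) * overlap n x y ^ p) hmean hC
    (fun y => by rw [hCv]; exact hn0) (auxPsi n T β m) (auxPsi_contDiff n T β m)
    (auxPsi_abs n hn T β m) g hgc hg0 (q * β) hgM
    (fun x h => auxPsi_fderiv n hn T β m hβ h x)
    (fun x y => (2 * π * n)⁻¹ * rexp (-(m ^ 2 / (n * (1 + |overlap n x y| ^ p)))) * (q * 2) ^ 2)
    (fun x y θ hθ => ?_)).trans (le_of_eq ?_)
  · have hr0 : 0 ≤ |overlap n x y| ^ p := by positivity
    obtain ⟨i1, i2⟩ := aux_gumbel β m (m / (n * (1 + |overlap n x y| ^ p))) hβ (by positivity) (by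
      rw [div_le_iff₀ (by positivity)]
      have : 0 ≤ β * n * |overlap n x y| ^ p := by positivity
      nlinarith)
    have he : (fun s => g s * rexp (-(m / (n * (1 + |overlap n x y| ^ p)) * (s - m)))) = fun s =>
      q * (β * rexp (-(β * (s - m))) * rexp (-rexp (-(β * (s - m)))) *
        rexp (-(m / (n * (1 + |overlap n x y| ^ p)) * (s - m)))) := by
      ext s; simp only [hg]; ring
    refine aux_biv μ (fun x y => (n : ℝ) * overlap n x y ^ p) hmean hC n hn0 hCv g hgc hg0 (q * β) hgM
      x y (|overlap n x y| ^ p) (hab x y) (hr1 x y) m ?_ (q * 2) ?_ θ hθ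
    · rw [he]; exact i1.const_mul q
    · rw [he, integral_const_mul]
      exact mul_le_mul_of_nonneg_left i2 hq0
  · simp only [hab]
    rw [Finset.sum_mul, Finset.mul_sum]
    refine Finset.sum_congr rfl fun y _ => ?_
    rw [Finset.sum_mul, Finset.mul_sum]
    refine Finset.sum_congr rfl fun x _ => ?_
    have h4 : ((4 : ℝ) ^ n)⁻¹ = ((2 : ℝ) ^ n)⁻¹ ^ 2 := by
      rw [show (4 : ℝ) = 2 ^ 2 by norm_num, ← pow_mul, mul_comm 2 n, pow_mul, inv_pow]
    rw [h4, hq]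
    have := pi_pos
    field_simp

lemma aux_ineq1 (G L r n M : ℝ) (hG : 0 ≤ G) (hL : 0 ≤ L) (hr : 0 ≤ r) (hn : 0 < n)
    (h : (G - 2 * L) * n ≤ M) : G - G * r - 2 * L ≤ M / (n * (1 + r)) := by
  rw [le_div_iff₀ (by positivity)]
  have e1 : 0 ≤ G * r ^ 2 := by positivity
  have e2 : 0 ≤ L * r := by positivity
  have e3 : (G - G * r - 2 * L) * (1 + r) = G - 2 * L - G * r ^ 2 - 2 * (L * r) := by ring
  calc (G - G * r - 2 * L) * (n * (1 + r)) = ((G - G * r - 2 * L) * (1 + r)) * n := by ring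
    _ ≤ (G - 2 * L) * n := mul_le_mul_of_nonneg_right (by rw [e3]; linarith) hn.le
    _ ≤ M := h

set_option maxHeartbeats 1000000 in
lemma aux_core (p : ℕ) (hp : 2 ≤ p) (c : ℝ) (β : ℕ → ℝ)
    {Ω : Type*} [MeasurableSpace Ω] (Pe : Measure Ω) [IsProbabilityMeasure Pe]
    (H : (n : ℕ) → V n → Ω → ℝ) (hHmeas : ∀ n x, Measurable (H n x))
    (hH : ∀ n : ℕ, IsCenteredGaussianVector Pe (H n)
      (fun x y => (n : ℝ) * overlap n x y ^ p))
    {Ω' : Type*} [MeasurableSpace Ω'] (Pw : Measure Ω') [IsProbabilityMeasure Pw]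
    (J : (n : ℕ) → ℕ → Ω' → V n) (e : ℕ → ℕ → Ω' → ℝ)
    (hJmeas : ∀ n i, Measurable (J n i)) (hemeas : ∀ n i, Measurable (e n i))
    (hlaw : WalkExpLaw Pw J e) (n : ℕ) (hn : 1 ≤ n) (t u L : ℝ) (ht : 0 < t) (hu : 0 < u)
    (hβ : 0 < β n) (hL : |log u| ≤ L) (hγ1 : γseq c n ^ 2 ≤ 1 / 8) (hγ2 : L ≤ γseq c n ^ 2 * n)
    (hγ3 : γseq c n + L / (γseq c n * n) ≤ β n) :
    (∫ ω, (nuMax Pw J e c β n t u (fun x => H n x ω) -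
          ∫ ω', nuMax Pw J e c β n t u (fun x => H n x ω') ∂Pe) ^ 2 ∂Pe)
        ≤ (2 * π * t ^ 2 * rexp (2 * L) * (2 * (1 + 8 ^ p * p.factorial))) *
          ((γseq c n) ^ 2)⁻¹ * (n : ℝ) ^ ((1 : ℝ) - (p : ℝ) / 2) := by
  have hn0 : (0 : ℝ) < n := by exact_mod_cast hn
  have hγ : 0 < γseq c n := Real.rpow_pos_of_pos hn0 _
  obtain ⟨l1, l2⟩ := abs_le.1 hL
  have hL0 : 0 ≤ L := (abs_nonneg _).trans hL
  set γ := γseq c n with hγd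
  set m := γ * n + log u / γ with hm
  have hm0 : 0 ≤ m := by
    have : m = (γ ^ 2 * n + log u) / γ := by rw [hm]; field_simp
    rw [this]
    exact div_nonneg (by linarith) hγ.le
  have hmβ : m ≤ β n * n := by
    have h1 : log u / γ ≤ L / γ := by gcongr
    have h2 : (γ + L / (γ * n)) * n = γ * n + L / γ := by field_simp
    have h3 := mul_le_mul_of_nonneg_right hγ3 hn0.le
    rw [h2] at h3
    linarith
  have hself : ∀ x : V n, overlap n x x = 1 := fun x => by simp [overlap]
  have hr1 : ∀ x y : V n, |overlap n x y| ^ p ≤ 1 := fun x y =>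
    pow_le_one₀ (abs_nonneg _) (aux_overlap_le n hn x y)
  have hr2 : ∀ x y : V n, |overlap n x y| ^ p ≤ overlap n x y ^ 2 := fun x y => by
    rw [← sq_abs]
    exact pow_le_pow_of_le_one (abs_nonneg _) (aux_overlap_le n hn x y) hp
  obtain ⟨hG, hmean, hcov⟩ := aux_env Pe (H n) (fun x y => (n : ℝ) * overlap n x y ^ p) (hHmeas n) (hH n)
    n hn0.le (fun x => by simp [hself]) (fun x y => by
      rw [abs_mul, abs_pow, abs_of_pos hn0]
      exact mul_le_of_le_one_right hn0.le (hr1 x y))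
    (fun x y => by simp only [overlap, hammingDist_comm])
  have hmeas : Measurable (fun ω x => H n x ω) := measurable_pi_lambda _ (hHmeas n)
  set μ := Pe.map (fun ω x => H n x ω) with hμ
  set Ψ := auxPsi n (θseq n) (β n) m with hΨ
  have hΨc : Continuous Ψ := (auxPsi_contDiff n (θseq n) (β n) m).continuous
  have hΨ1 : ∀ h, |Ψ h| ≤ 1 := auxPsi_abs n hn (θseq n) (β n) m
  have hvar := aux_varPsi p n hn (θseq n) (β n) m hβ hm0 hmβ μ hmean hcov
  rw [← hΨ] at hvar
  set k : ℝ := (kseq c n t : ℝ) with hk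
  have hΨi : Integrable Ψ μ := Integrable.of_bound hΨc.aestronglyMeasurable 1
    (Eventually.of_forall hΨ1)
  have hΨi2 : Integrable (fun h => Ψ h ^ 2) μ := by
    refine Integrable.of_bound (hΨc.pow 2).aestronglyMeasurable 1 (Eventually.of_forall fun h => ?_)
    rw [norm_pow]
    exact pow_le_one₀ (norm_nonneg _) (hΨ1 h)
  have hnu : ∀ h, nuMax Pw J e c β n t u h = k * (1 - Ψ h) := fun h =>
    aux_nuMax Pw J e hJmeas hemeas hlaw c β n hn t u hu h
  set A := ∫ h, Ψ h ∂μ with hA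
  have hmeanint : ∫ ω', nuMax Pw J e c β n t u (fun x => H n x ω') ∂Pe = k * (1 - A) := by
    simp only [hnu]
    rw [integral_const_mul, ← integral_map (μ := Pe) hmeas.aemeasurable (f := fun h => 1 - Ψ h)
      (Continuous.aestronglyMeasurable (by fun_prop)), integral_sub (integrable_const _) hΨi]
    simp [hA]
  rw [hmeanint]
  simp only [hnu]
  have hv2 : ∫ ω, (k * (1 - Ψ (fun x => H n x ω)) - k * (1 - A)) ^ 2 ∂Pe =
      k ^ 2 * (∫ h, Ψ h ^ 2 ∂μ - A ^ 2) := by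
    rw [← integral_map (μ := Pe) hmeas.aemeasurable (f := fun h => (k * (1 - Ψ h) - k * (1 - A)) ^ 2)
      (Continuous.aestronglyMeasurable (by fun_prop))]
    have : (fun h => (k * (1 - Ψ h) - k * (1 - A)) ^ 2) = fun h =>
        k ^ 2 * ((Ψ h ^ 2 - (2 * A) * Ψ h) + A ^ 2) := by ext h; ring
    rw [this, integral_const_mul, integral_add (hΨi2.aux_isub (hΨi.const_mul _)) (integrable_const _),
      integral_sub hΨi2 (hΨi.const_mul _), integral_const_mul, ← hA]
    simp
    left; ring
  rw [hv2]
  have hkθ : (k * (θseq n : ℝ)) ^ 2 ≤ 2 * π * n * (γ ^ 2)⁻¹ * rexp (γ ^ 2 * n) * t ^ 2 := by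
    have ha0 : 0 ≤ aseq c n * t := by
      unfold aseq
      rw [← hγd]
      positivity
    have h1 : k * (θseq n : ℝ) ≤ aseq c n * t := by
      refine le_trans ?_ (Nat.floor_le ha0)
      rw [hk]
      exact_mod_cast Nat.div_mul_le_self _ _
    calc (k * (θseq n : ℝ)) ^ 2 ≤ (aseq c n * t) ^ 2 := by
          gcongr
      _ = _ := by
        unfold aseq
        rw [← hγd, mul_pow, mul_pow, mul_pow, Real.sq_sqrt (by positivity), inv_pow, ← exp_nat_mul]
        congr 3
        push_cast; ring
  have hterm : ∀ x y : V n, rexp (γ ^ 2 * n) * (|overlap n x y| ^ p * rexp (-(m ^ 2 / (n * (1 + |overlap n x y| ^ p))))) ≤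
      rexp (2 * L) * (|overlap n x y| ^ p * rexp (γ ^ 2 * n * overlap n x y ^ 2)) := by
    intro x y
    set r := |overlap n x y| ^ p with hr
    have hr0 : 0 ≤ r := by positivity
    have hrR := hr2 x y
    rw [← hr] at hrR
    have hmm : (γ ^ 2 * n - 2 * L) * n ≤ m ^ 2 := by
      have : m ^ 2 = (γ * n) ^ 2 + 2 * n * log u + (log u / γ) ^ 2 := by
        rw [hm]; field_simp; ring
      rw [this]
      have q1 := sq_nonneg (log u / γ)
      have q2 : 0 ≤ (log u + L) * n := mul_nonneg (by linarith) hn0.le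
      have q3 : (γ * n) ^ 2 + 2 * n * log u = (γ ^ 2 * n - 2 * L) * n + 2 * ((log u + L) * n) := by ring
      linarith
    have h1 : γ ^ 2 * n - γ ^ 2 * n * r - 2 * L ≤ m ^ 2 / (n * (1 + r)) :=
      aux_ineq1 (γ ^ 2 * n) L r n (m ^ 2) (by positivity) hL0 hr0 hn0 hmm
    have h2 : γ ^ 2 * n * r ≤ γ ^ 2 * n * overlap n x y ^ 2 := by gcongr
    calc _ = r * rexp (γ ^ 2 * n - m ^ 2 / (n * (1 + r))) := by
          rw [sub_eq_add_neg, exp_add]; ring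
      _ ≤ r * rexp (2 * L + γ ^ 2 * n * overlap n x y ^ 2) := by
          refine mul_le_mul_of_nonneg_left (exp_le_exp.2 ?_) hr0
          linarith
      _ = _ := by rw [exp_add]; ring
  set S1 := ∑ y : V n, ∑ x : V n,
        |overlap n x y| ^ p * rexp (-(m ^ 2 / (n * (1 + |overlap n x y| ^ p)))) with hS1
  have hS0 : 0 ≤ S1 := Finset.sum_nonneg fun y _ => Finset.sum_nonneg fun x _ => by positivity
  have hsum : rexp (γ ^ 2 * n) * S1 ≤ rexp (2 * L) *
      (4 ^ n * (2 * (1 + 8 ^ p * p.factorial)) * (n : ℝ) ^ (-((p : ℝ) / 2))) := by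
    refine le_trans ?_ (mul_le_mul_of_nonneg_left (aux_sumbound p n hn (γ ^ 2) hγ1) (exp_pos _).le)
    rw [hS1, Finset.mul_sum, Finset.mul_sum]
    refine Finset.sum_le_sum fun y _ => ?_
    rw [Finset.mul_sum, Finset.mul_sum]
    exact Finset.sum_le_sum fun x _ => hterm x y
  have hnp : (n : ℝ) ^ ((1 : ℝ) - (p : ℝ) / 2) = n * (n : ℝ) ^ (-((p : ℝ) / 2)) := by
    rw [sub_eq_add_neg, Real.rpow_add hn0, Real.rpow_one]
  rw [hnp]
  calc k ^ 2 * (∫ h, Ψ h ^ 2 ∂μ - A ^ 2) ≤ k ^ 2 * ((θseq n : ℝ) ^ 2 * ((4 : ℝ) ^ n)⁻¹ * S1) :=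
        mul_le_mul_of_nonneg_left hvar (sq_nonneg _)
    _ = (k * (θseq n : ℝ)) ^ 2 * (((4 : ℝ) ^ n)⁻¹ * S1) := by ring
    _ ≤ (2 * π * n * (γ ^ 2)⁻¹ * rexp (γ ^ 2 * n) * t ^ 2) * (((4 : ℝ) ^ n)⁻¹ * S1) :=
        mul_le_mul_of_nonneg_right hkθ (by positivity)
    _ = (2 * π * n * (γ ^ 2)⁻¹ * t ^ 2 * ((4 : ℝ) ^ n)⁻¹) * (rexp (γ ^ 2 * n) * S1) := by ring
    _ ≤ (2 * π * n * (γ ^ 2)⁻¹ * t ^ 2 * ((4 : ℝ) ^ n)⁻¹) * (rexp (2 * L) *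
      (4 ^ n * (2 * (1 + 8 ^ p * p.factorial)) * (n : ℝ) ^ (-((p : ℝ) / 2)))) :=
        mul_le_mul_of_nonneg_left hsum (by positivity)
    _ = (2 * π * n * (γ ^ 2)⁻¹ * t ^ 2 * (((4 : ℝ) ^ n)⁻¹ * 4 ^ n)) * (rexp (2 * L) *
      ((2 * (1 + 8 ^ p * p.factorial)) * (n : ℝ) ^ (-((p : ℝ) / 2)))) := by ring
    _ = _ := by
        rw [inv_mul_cancel₀ (by positivity)]; ring

lemma aux_asymp (c : ℝ) (hc0 : 0 < c) (hc1 : c < 1 / 2) (L β₀ : ℝ) (hβ₀ : 0 < β₀) :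
    ∃ N : ℕ, ∀ n : ℕ, N ≤ n → 1 ≤ n ∧ γseq c n ^ 2 ≤ 1 / 8 ∧ L ≤ γseq c n ^ 2 * n ∧
      γseq c n + L / (γseq c n * n) ≤ β₀ := by
  have t1 : Tendsto (fun n : ℕ => γseq c n) atTop (nhds 0) :=
    (tendsto_rpow_neg_atTop hc0).comp tendsto_natCast_atTop_atTop
  have t2 : Tendsto (fun n : ℕ => γseq c n ^ 2) atTop (nhds 0) := by simpa using t1.pow 2
  have t3 : Tendsto (fun n : ℕ => γseq c n ^ 2 * n) atTop atTop := by
    have : Tendsto (fun n : ℕ => (n : ℝ) ^ (1 - 2 * c)) atTop atTop :=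
      (tendsto_rpow_atTop (by linarith)).comp tendsto_natCast_atTop_atTop
    refine this.congr' ?_
    filter_upwards [eventually_ge_atTop 1] with n hn
    have hn0 : (0 : ℝ) < n := by exact_mod_cast hn
    rw [γseq, ← Real.rpow_natCast, ← Real.rpow_mul hn0.le, ← Real.rpow_add_one hn0.ne']
    congr 1; push_cast; ring
  have t4 : Tendsto (fun n : ℕ => γseq c n * n) atTop atTop := by
    have : Tendsto (fun n : ℕ => (n : ℝ) ^ (1 - c)) atTop atTop :=
      (tendsto_rpow_atTop (by linarith)).comp tendsto_natCast_atTop_atTop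
    refine this.congr' ?_
    filter_upwards [eventually_ge_atTop 1] with n hn
    have hn0 : (0 : ℝ) < n := by exact_mod_cast hn
    rw [γseq, ← Real.rpow_add_one hn0.ne']
    congr 1; ring
  have t5 : Tendsto (fun n : ℕ => γseq c n + L / (γseq c n * n)) atTop (nhds 0) := by
    simpa using t1.add (t4.const_div_atTop L)
  have := (eventually_ge_atTop 1).and ((t2.eventually_le_const (show (0 : ℝ) < 1 / 8 by norm_num)).and
    ((t3.eventually_ge_atTop L).and (t5.eventually_le_const hβ₀)))
  exact eventually_atTop.1 this

lemma aux_logbd (c : ℝ) (hc0 : 0 < c) (β₀ b : ℝ) (hβ₀ : 0 < β₀) (hb : β₀ ≤ b) (n : ℕ) (hn : 1 ≤ n)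
    (u : ℝ) (hu : 0 < u) :
    |log (u * (θseq n : ℝ) ^ (-(γseq c n / b)))| ≤ |log u| + (log 3 + 2 / c) / β₀ := by
  have hn0 : (0 : ℝ) < n := by exact_mod_cast hn
  have hn1 : (1 : ℝ) ≤ n := by exact_mod_cast hn
  have hγ : 0 < γseq c n := Real.rpow_pos_of_pos hn0 _
  have hγ1 : γseq c n ≤ 1 := Real.rpow_le_one_of_one_le_of_nonpos hn1 (by linarith)
  have hb0 : 0 < b := by linarith
  have hθ : (θseq n : ℝ) = 3 * (n : ℝ) ^ 2 := by simp [θseq]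
  have hθ0 : 0 < (θseq n : ℝ) := by rw [hθ]; positivity
  have hlog : log (θseq n : ℝ) = log 3 + 2 * log n := by
    rw [hθ, Real.log_mul (by norm_num) (by positivity), Real.log_pow]; push_cast; ring
  have hl3 : 0 ≤ log 3 := Real.log_nonneg (by norm_num)
  have hln : 0 ≤ log (n : ℝ) := Real.log_nonneg hn1
  rw [Real.log_mul hu.ne' (by positivity), Real.log_rpow hθ0]
  refine (abs_add_le _ _).trans (add_le_add_right ?_ _)
  rw [neg_mul, abs_neg, abs_of_nonneg (by rw [hlog]; positivity), hlog, div_mul_eq_mul_div]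
  have h1 : γseq c n * log n ≤ 1 / c := by
    have := Real.log_le_rpow_div hn0.le hc0
    calc γseq c n * log n ≤ γseq c n * ((n : ℝ) ^ c / c) := by gcongr
      _ = 1 / c := by
        rw [γseq, ← mul_div_assoc, ← Real.rpow_add hn0]; simp
  have h2 : γseq c n * (log 3 + 2 * log n) ≤ log 3 + 2 / c := by
    have : γseq c n * log 3 ≤ log 3 := mul_le_of_le_one_left hl3 hγ1
    have h3 : 2 / c = 2 * (1 / c) := by ring
    rw [h3]
    nlinarith
  calc _ ≤ (log 3 + 2 / c) / b := by gcongr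
    _ ≤ _ := by gcongr

theorem variance_nuMax_bound
    (p : ℕ) (hp : 2 ≤ p) (c : ℝ) (hc0 : 0 < c) (hc1 : c < 1 / 2)
    (β : ℕ → ℝ) (β₀ : ℝ) (hβ₀ : 0 < β₀) (hβ : ∀ n : ℕ, β₀ ≤ β n)
    (B : ℝ) (hB : ∀ n : ℕ, γseq c n * β n ≤ B)
    {Ω : Type*} [MeasurableSpace Ω] (Pe : Measure Ω) [IsProbabilityMeasure Pe]
    (H : (n : ℕ) → V n → Ω → ℝ) (hHmeas : ∀ n x, Measurable (H n x))
    (hH : ∀ n : ℕ, IsCenteredGaussianVector Pe (H n)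
      (fun x y => (n : ℝ) * overlap n x y ^ p))
    {Ω' : Type*} [MeasurableSpace Ω'] (Pw : Measure Ω') [IsProbabilityMeasure Pw]
    (J : (n : ℕ) → ℕ → Ω' → V n) (e : ℕ → ℕ → Ω' → ℝ)
    (hJmeas : ∀ n i, Measurable (J n i)) (hemeas : ∀ n i, Measurable (e n i))
    (hlaw : WalkExpLaw Pw J e) :
    ∀ u : ℝ, 0 < u → ∀ t : ℝ, 0 < t → ∃ C : ℝ, ∃ N : ℕ, ∀ n : ℕ, N ≤ n →
      (∫ ω, (nuMax Pw J e c β n t u (fun x => H n x ω) -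
          ∫ ω', nuMax Pw J e c β n t u (fun x => H n x ω') ∂Pe) ^ 2 ∂Pe)
        ≤ C * ((γseq c n) ^ 2)⁻¹ * (n : ℝ) ^ ((1 : ℝ) - (p : ℝ) / 2) ∧
      (∫ ω, (nuMax Pw J e c β n t (u * (θseq n : ℝ) ^ (-(γseq c n / β n)))
            (fun x => H n x ω) -
          ∫ ω', nuMax Pw J e c β n t (u * (θseq n : ℝ) ^ (-(γseq c n / β n)))
            (fun x => H n x ω') ∂Pe) ^ 2 ∂Pe)
        ≤ C * ((γseq c n) ^ 2)⁻¹ * (n : ℝ) ^ ((1 : ℝ) - (p : ℝ) / 2) := by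
  intro u hu t ht
  set L := |log u| + (log 3 + 2 / c) / β₀ with hL
  obtain ⟨N, hN⟩ := aux_asymp c hc0 hc1 L β₀ hβ₀
  refine ⟨2 * π * t ^ 2 * rexp (2 * L) * (2 * (1 + 8 ^ p * p.factorial)), N, fun n hn => ?_⟩
  obtain ⟨h1, h2, h3, h4⟩ := hN n hn
  have hβn : 0 < β n := hβ₀.trans_le (hβ n)
  have hθ0 : 0 < (θseq n : ℝ) := by
    have : (θseq n : ℝ) = 3 * (n : ℝ) ^ 2 := by simp [θseq]
    rw [this]
    have : (0 : ℝ) < n := by exact_mod_cast h1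
    positivity
  constructor
  · refine aux_core p hp c β Pe H hHmeas hH Pw J e hJmeas hemeas hlaw n h1 t u L ht hu hβn ?_ h2 h3
      (h4.trans (hβ n))
    have hl3 : 0 ≤ log 3 := Real.log_nonneg (by norm_num)
    have : 0 ≤ (log 3 + 2 / c) / β₀ := by positivity
    linarith
  · exact aux_core p hp c β Pe H hHmeas hH Pw J e hJmeas hemeas hlaw n h1 t _ L ht
      (mul_pos hu (Real.rpow_pos_of_pos hθ0 _)) hβn (aux_logbd c hc0 β₀ (β n) hβ₀ (hβ n) n h1 u hu)
      h2 h3 (h4.trans (hβ n))
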